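/- Estimate of the term I₇: there exists a constant C > 0 depending only on τ₀ such that, under the standing assumptions, ∑_{n≥0} ∑_{|α|=n} |I^α_7| τⁿ Mₙ / ‖θ ⟨r⟩ⁿ ∂^α_h g‖_{L²} ≤ C τ^{−2} ( ⟨t⟩^{−1/4} ‖g‖_{X_τ} + ⟨t⟩^{1/4} ‖g‖_{D_τ} ) ( ‖g‖_{X_τ} + ‖g‖_{Y_τ} ). -/

import Mathlib

open MeasureTheory Filter Set

noncomputable section

/-- `⟨t⟩ = 1 + t` -/
def angT (t : ℝ) : ℝ := 1 + t

/-- `θ_λ(z) = exp (λ z² / (8⟨t⟩))`; `θ = θ₁`. -/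
def thw (t lam z : ℝ) : ℝ := Real.exp (lam * z ^ 2 / (8 * angT t))

/-- `⟨r⟩ = √(x² + y² + 1)` -/
def angR (x y : ℝ) : ℝ := Real.sqrt (x ^ 2 + y ^ 2 + 1)

/-- `Mₙ = (n+1)⁴ / n!` -/
def Mfac (n : ℕ) : ℝ := ((n : ℝ) + 1) ^ 4 / (n.factorial : ℝ)

/-- `∂_x` -/
def pdx (f : ℝ → ℝ → ℝ → ℝ) : ℝ → ℝ → ℝ → ℝ := fun x y z => deriv (fun x' => f x' y z) x
/-- `∂_y` -/
def pdy (f : ℝ → ℝ → ℝ → ℝ) : ℝ → ℝ → ℝ → ℝ := fun x y z => deriv (fun y' => f x y' z) y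
/-- `∂_z` -/
def pdz (f : ℝ → ℝ → ℝ → ℝ) : ℝ → ℝ → ℝ → ℝ := fun x y z => deriv (fun z' => f x y z') z

/-- `∂^α_h = ∂_x^{α₁} ∂_y^{α₂}` for the multi-index `α = (a, b)` -/
def pdh (a b : ℕ) (f : ℝ → ℝ → ℝ → ℝ) : ℝ → ℝ → ℝ → ℝ := pdx^[a] (pdy^[b] f)

/-- `r ∂_r = x ∂_x + y ∂_y` -/
def rdr (f : ℝ → ℝ → ℝ → ℝ) : ℝ → ℝ → ℝ → ℝ := fun x y z => x * pdx f x y z + y * pdy f x y z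

/-- weighted `L²` norm over `ℝ² × (0,∞)` of `θ_λ ⟨r⟩ⁿ f` -/
def L2w (t lam : ℝ) (n : ℕ) (f : ℝ → ℝ → ℝ → ℝ) : ℝ :=
  Real.sqrt (∫ x : ℝ, ∫ y : ℝ, ∫ z in Ioi (0 : ℝ), (thw t lam z * angR x y ^ n * f x y z) ^ 2)

/-- weighted `L²_z` norm at fixed `(x, y)` of `θ_λ ⟨r⟩ⁿ f (x, y, ·)` -/
def L2z (t lam : ℝ) (n : ℕ) (f : ℝ → ℝ → ℝ → ℝ) (x y : ℝ) : ℝ :=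
  Real.sqrt (∫ z in Ioi (0 : ℝ), (thw t lam z * angR x y ^ n * f x y z) ^ 2)

/-- mixed `L^∞_h L²_z` norm of `θ_λ ⟨r⟩ⁿ f` -/
def LIh2z (t lam : ℝ) (n : ℕ) (f : ℝ → ℝ → ℝ → ℝ) : ℝ :=
  Real.sqrt (∫ z in Ioi (0 : ℝ), (⨆ p : ℝ × ℝ, |thw t lam z * angR p.1 p.2 ^ n * f p.1 p.2 z|) ^ 2)

/-- mixed `L²_h L^∞_z` norm of `θ_λ ⟨r⟩ⁿ f` -/
def L2hIz (t lam : ℝ) (n : ℕ) (f : ℝ → ℝ → ℝ → ℝ) : ℝ :=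
  Real.sqrt (∫ x : ℝ, ∫ y : ℝ,
    (⨆ z : Ioi (0 : ℝ), |thw t lam (z : ℝ) * angR x y ^ n * f x y (z : ℝ)|) ^ 2)

/-- the primitive `φ(x,y,z) = exp(−z²/(4⟨t⟩)) ∫₀^z g(x,y,s) exp(s²/(4⟨t⟩)) ds` -/
def phiF (t : ℝ) (g : ℝ → ℝ → ℝ → ℝ) : ℝ → ℝ → ℝ → ℝ := fun x y z =>
  Real.exp (-(z ^ 2) / (4 * angT t)) * ∫ s in (0 : ℝ)..z, g x y s * Real.exp (s ^ 2 / (4 * angT t))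

/-- `u^r = ∂_z φ` -/
def ur (t : ℝ) (g : ℝ → ℝ → ℝ → ℝ) : ℝ → ℝ → ℝ → ℝ := pdz (phiF t g)

/-- `u^z = −(x∂_x + y∂_y)φ − 2φ` -/
def uzv (t : ℝ) (g : ℝ → ℝ → ℝ → ℝ) : ℝ → ℝ → ℝ → ℝ := fun x y z =>
  -(rdr (phiF t g) x y z) - 2 * phiF t g x y z

/-- smoothness together with rapid decay in `z` of all derivatives -/
def DecaySmooth (g : ℝ → ℝ → ℝ → ℝ) : Prop :=
  ContDiff ℝ (⊤ : ℕ∞) (fun p : ℝ × ℝ × ℝ => g p.1 p.2.1 p.2.2) ∧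
  ∀ a b k m : ℕ, ∀ x y : ℝ,
    Tendsto (fun z : ℝ => z ^ m * pdz^[k] (pdh a b g) x y z) atTop (nhds 0)

/-- `θ ⟨r⟩^{|α|} ∂^α_h g ∈ L²(ℝ² × (0,∞))` for every `α` -/
def L2cond (t : ℝ) (g : ℝ → ℝ → ℝ → ℝ) : Prop :=
  ∀ a b : ℕ,
    Integrable
      (fun p : ℝ × ℝ × ℝ =>
        (thw t 1 p.2.2 * angR p.1 p.2.1 ^ (a + b) * pdh a b g p.1 p.2.1 p.2.2) ^ 2)
      (volume.restrict {p : ℝ × ℝ × ℝ | 0 < p.2.2})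

/-- `θ ⟨r⟩^{|α|} ∂^α_h ∂_z g ∈ L²(ℝ² × (0,∞))` for every `α` -/
def L2condZ (t : ℝ) (g : ℝ → ℝ → ℝ → ℝ) : Prop :=
  ∀ a b : ℕ,
    Integrable
      (fun p : ℝ × ℝ × ℝ =>
        (thw t 1 p.2.2 * angR p.1 p.2.1 ^ (a + b) * pdh a b (pdz g) p.1 p.2.1 p.2.2) ^ 2)
      (volume.restrict {p : ℝ × ℝ × ℝ | 0 < p.2.2})

/-- `X_n(g, τ)` -/
def Xel (t τ : ℝ) (g : ℝ → ℝ → ℝ → ℝ) (n : ℕ) : ℝ :=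
  (∑ a ∈ Finset.range (n + 1), L2w t 1 n (pdh a (n - a) g)) * τ ^ n * Mfac n

/-- `D_n(g, τ) = X_n(∂_z g, τ)` -/
def Del (t τ : ℝ) (g : ℝ → ℝ → ℝ → ℝ) (n : ℕ) : ℝ :=
  (∑ a ∈ Finset.range (n + 1), L2w t 1 n (pdh a (n - a) (pdz g))) * τ ^ n * Mfac n

/-- `Y_n(g, τ)` (with `Y₀ = 0`) -/
def Yel (t τ : ℝ) (g : ℝ → ℝ → ℝ → ℝ) (n : ℕ) : ℝ :=
  (∑ a ∈ Finset.range (n + 1), L2w t 1 n (pdh a (n - a) g)) * τ ^ (n - 1) * (n : ℝ) * Mfac n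

/-- `‖g‖_{X_τ}` -/
def Xnrm (t τ : ℝ) (g : ℝ → ℝ → ℝ → ℝ) : ℝ := ∑' n : ℕ, Xel t τ g n
/-- `‖g‖_{D_τ}` -/
def Dnrm (t τ : ℝ) (g : ℝ → ℝ → ℝ → ℝ) : ℝ := ∑' n : ℕ, Del t τ g n
/-- `‖g‖_{Y_τ}` -/
def Ynrm (t τ : ℝ) (g : ℝ → ℝ → ℝ → ℝ) : ℝ := ∑' n : ℕ, Yel t τ g n

/-- triple integral over `ℝ² × (0,∞)` -/
def trip (F : ℝ → ℝ → ℝ → ℝ) : ℝ := ∫ x : ℝ, ∫ y : ℝ, ∫ z in Ioi (0 : ℝ), F x y z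

/-- `I^α_1` -/
def I1 (t : ℝ) (g : ℝ → ℝ → ℝ → ℝ) (a b : ℕ) : ℝ :=
  -trip fun x y z =>
    thw t 2 z * angR x y ^ (2 * (a + b)) *
      pdh a b (fun x' y' z' => ur t g x' y' z' * rdr g x' y' z') x y z * pdh a b g x y z

/-- `I^α_2` -/
def I2 (t : ℝ) (g : ℝ → ℝ → ℝ → ℝ) (a b : ℕ) : ℝ :=
  -trip fun x y z =>
    thw t 2 z * angR x y ^ (2 * (a + b)) *
      pdh a b (fun x' y' z' => uzv t g x' y' z' * pdz g x' y' z') x y z * pdh a b g x y z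

/-- `I^α_3` -/
def I3 (t : ℝ) (g : ℝ → ℝ → ℝ → ℝ) (a b : ℕ) : ℝ :=
  -trip fun x y z =>
    thw t 2 z * angR x y ^ (2 * (a + b)) *
      pdh a b (fun x' y' z' => ur t g x' y' z' ^ 2) x y z * pdh a b g x y z

/-- `I^α_4` -/
def I4 (t : ℝ) (g : ℝ → ℝ → ℝ → ℝ) (a b : ℕ) : ℝ :=
  (1 / (2 * angT t)) * trip fun x y z =>
    thw t 2 z * angR x y ^ (2 * (a + b)) *
      pdh a b
        (fun x' y' z' =>
          uzv t g x' y' z' * pdz (fun x'' y'' w => w * phiF t g x'' y'' w) x' y' z') x y z *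
      pdh a b g x y z

/-- `I^α_5` -/
def I5 (t : ℝ) (g : ℝ → ℝ → ℝ → ℝ) (a b : ℕ) : ℝ :=
  -(1 / angT t) * trip fun x y z =>
    z * thw t 2 z * angR x y ^ (2 * (a + b)) *
      pdh a b (fun x' y' z' => ur t g x' y' z' * phiF t g x' y' z') x y z * pdh a b g x y z

/-- `I^α_6` -/
def I6 (t : ℝ) (g : ℝ → ℝ → ℝ → ℝ) (a b : ℕ) : ℝ :=
  -(1 / (2 * angT t)) * trip fun x y z =>
    z * thw t 2 z * angR x y ^ (2 * (a + b)) *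
      (∫ s in Ioi z, pdh a b (fun x' y' z' => ur t g x' y' z' ^ 2) x y s) * pdh a b g x y z

/-- `I^α_7` -/
def I7 (t : ℝ) (g : ℝ → ℝ → ℝ → ℝ) (a b : ℕ) : ℝ :=
  (1 / angT t) * trip fun x y z =>
    z * thw t 2 z * angR x y ^ (2 * (a + b)) *
      (∫ s in Ioi z, pdh a b (fun x' y' z' => pdz (ur t g) x' y' z' * uzv t g x' y' z') x y s) *
      pdh a b g x y z

/-- `∑_{|α| = n} |I^α| τⁿ Mₙ / ‖θ ⟨r⟩ⁿ ∂^α_h g‖_{L²}` (with the convention `x / 0 = 0`) -/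
def Qterm (t τ : ℝ) (g : ℝ → ℝ → ℝ → ℝ) (I : ℕ → ℕ → ℝ) (n : ℕ) : ℝ :=
  ∑ a ∈ Finset.range (n + 1), |I a (n - a)| * τ ^ n * Mfac n / L2w t 1 n (pdh a (n - a) g)

/-- `∂_t` -/
def pdt (G : ℝ → ℝ → ℝ → ℝ → ℝ) (t x y z : ℝ) : ℝ := deriv (fun t' => G t' x y z) t

/-- the good-unknown axially symmetric Prandtl equation at the point `(t, x, y, z)` -/
def GoodEq (G : ℝ → ℝ → ℝ → ℝ → ℝ) (t x y z : ℝ) : Prop :=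
  pdt G t x y z
      + ur t (G t) x y z * rdr (G t) x y z
      + uzv t (G t) x y z * pdz (G t) x y z
      - pdz (pdz (G t)) x y z
      + G t x y z / angT t
      + ur t (G t) x y z ^ 2
      - 1 / (2 * angT t) * (uzv t (G t) x y z * pdz (fun x' y' w => w * phiF t (G t) x' y' w) x y z)
      + z / angT t * (ur t (G t) x y z * phiF t (G t) x y z)
      + z / (2 * angT t) * (∫ s in Ioi z, ur t (G t) x y s ^ 2)
      - z / angT t * (∫ s in Ioi z, pdz (ur t (G t)) x y s * uzv t (G t) x y s) = 0

/-- joint smoothness of a function of three real variables -/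
def Smooth3 (f : ℝ → ℝ → ℝ → ℝ) : Prop :=
  ContDiff ℝ (⊤ : ℕ∞) (fun p : ℝ × ℝ × ℝ => f p.1 p.2.1 p.2.2)

namespace Smooth3

variable {f g : ℝ → ℝ → ℝ → ℝ}

lemma hasFDerivAt (hf : Smooth3 f) (p : ℝ × ℝ × ℝ) :
    HasFDerivAt (fun p : ℝ × ℝ × ℝ => f p.1 p.2.1 p.2.2)
      (fderiv ℝ (fun p : ℝ × ℝ × ℝ => f p.1 p.2.1 p.2.2) p) p :=
  (hf.differentiable (by simp)).differentiableAt.hasFDerivAt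

lemma hasDerivAt_fderiv_x (hf : Smooth3 f) (x y z : ℝ) :
    HasDerivAt (fun x' => f x' y z)
      (fderiv ℝ (fun p : ℝ × ℝ × ℝ => f p.1 p.2.1 p.2.2) (x, y, z) (1, 0, 0)) x := by
  have h1 : HasDerivAt (fun x' : ℝ => (x', y, z)) (1, 0, 0) x :=
    (hasDerivAt_id x).prodMk (hasDerivAt_const x (y, z))
  exact (hf.hasFDerivAt (x, y, z)).comp_hasDerivAt x h1

lemma hasDerivAt_fderiv_y (hf : Smooth3 f) (x y z : ℝ) :
    HasDerivAt (fun y' => f x y' z)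
      (fderiv ℝ (fun p : ℝ × ℝ × ℝ => f p.1 p.2.1 p.2.2) (x, y, z) (0, 1, 0)) y := by
  have h1 : HasDerivAt (fun y' : ℝ => (x, y', z)) (0, 1, 0) y :=
    (hasDerivAt_const y x).prodMk ((hasDerivAt_id y).prodMk (hasDerivAt_const y z))
  exact (hf.hasFDerivAt (x, y, z)).comp_hasDerivAt y h1

lemma hasDerivAt_fderiv_z (hf : Smooth3 f) (x y z : ℝ) :
    HasDerivAt (fun z' => f x y z')
      (fderiv ℝ (fun p : ℝ × ℝ × ℝ => f p.1 p.2.1 p.2.2) (x, y, z) (0, 0, 1)) z := by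
  have h1 : HasDerivAt (fun z' : ℝ => (x, y, z')) (0, 0, 1) z :=
    (hasDerivAt_const z x).prodMk ((hasDerivAt_const z y).prodMk (hasDerivAt_id z))
  exact (hf.hasFDerivAt (x, y, z)).comp_hasDerivAt z h1

lemma pdx_eq (hf : Smooth3 f) : pdx f = fun x y z =>
    fderiv ℝ (fun p : ℝ × ℝ × ℝ => f p.1 p.2.1 p.2.2) (x, y, z) (1, 0, 0) := by
  funext x y z
  exact (hf.hasDerivAt_fderiv_x x y z).deriv

lemma pdy_eq (hf : Smooth3 f) : pdy f = fun x y z =>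
    fderiv ℝ (fun p : ℝ × ℝ × ℝ => f p.1 p.2.1 p.2.2) (x, y, z) (0, 1, 0) := by
  funext x y z
  exact (hf.hasDerivAt_fderiv_y x y z).deriv

lemma pdz_eq (hf : Smooth3 f) : pdz f = fun x y z =>
    fderiv ℝ (fun p : ℝ × ℝ × ℝ => f p.1 p.2.1 p.2.2) (x, y, z) (0, 0, 1) := by
  funext x y z
  exact (hf.hasDerivAt_fderiv_z x y z).deriv

lemma hasDerivAt_x (hf : Smooth3 f) (x y z : ℝ) :
    HasDerivAt (fun x' => f x' y z) (pdx f x y z) x := by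
  rw [hf.pdx_eq]; exact hf.hasDerivAt_fderiv_x x y z

lemma hasDerivAt_y (hf : Smooth3 f) (x y z : ℝ) :
    HasDerivAt (fun y' => f x y' z) (pdy f x y z) y := by
  rw [hf.pdy_eq]; exact hf.hasDerivAt_fderiv_y x y z

lemma hasDerivAt_z (hf : Smooth3 f) (x y z : ℝ) :
    HasDerivAt (fun z' => f x y z') (pdz f x y z) z := by
  rw [hf.pdz_eq]; exact hf.hasDerivAt_fderiv_z x y z

lemma fderiv_apply (hf : Smooth3 f) (v : ℝ × ℝ × ℝ) :
    Smooth3 fun x y z => fderiv ℝ (fun p : ℝ × ℝ × ℝ => f p.1 p.2.1 p.2.2) (x, y, z) v :=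
  (hf.fderiv_right (m := (⊤ : ℕ∞)) (by simp)).clm_apply contDiff_const

protected lemma pdx (hf : Smooth3 f) : Smooth3 (pdx f) := by
  rw [hf.pdx_eq]; exact hf.fderiv_apply _

protected lemma pdy (hf : Smooth3 f) : Smooth3 (pdy f) := by
  rw [hf.pdy_eq]; exact hf.fderiv_apply _

protected lemma pdz (hf : Smooth3 f) : Smooth3 (pdz f) := by
  rw [hf.pdz_eq]; exact hf.fderiv_apply _

lemma pdy_pdx (hf : Smooth3 f) : pdy (_root_.pdx f) = _root_.pdx (_root_.pdy f) := by
  rw [hf.pdx.pdy_eq, hf.pdy.pdx_eq, hf.pdx_eq, hf.pdy_eq]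
  funext x y z
  have hd : DifferentiableAt ℝ
      (fderiv ℝ (fun p : ℝ × ℝ × ℝ => f p.1 p.2.1 p.2.2)) (x, y, z) :=
    ((hf.fderiv_right (m := (⊤ : ℕ∞)) (by simp)).differentiable (by simp)).differentiableAt
  have key : ∀ v w : ℝ × ℝ × ℝ, fderiv ℝ (fun p : ℝ × ℝ × ℝ =>
      fderiv ℝ (fun p : ℝ × ℝ × ℝ => f p.1 p.2.1 p.2.2) p v) (x, y, z) w =
      fderiv ℝ (fderiv ℝ (fun p : ℝ × ℝ × ℝ => f p.1 p.2.1 p.2.2)) (x, y, z) w v := by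
    intro v w
    rw [fderiv_clm_apply hd (by fun_prop)]
    simp
  have hs : IsSymmSndFDerivAt ℝ (fun p : ℝ × ℝ × ℝ => f p.1 p.2.1 p.2.2) (x, y, z) :=
    (ContDiff.contDiffAt hf).isSymmSndFDerivAt (by simpa using WithTop.coe_le_coe.2 (le_top : (2 : ℕ∞) ≤ ⊤))
  simp only [Prod.mk.eta]
  rw [key, key, hs]

lemma pdy_iterate (hf : Smooth3 f) (b : ℕ) : Smooth3 (_root_.pdy^[b] f) := by
  induction b with
  | zero => exact hf
  | succ b ih => rw [Function.iterate_succ_apply']; exact ih.pdy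

protected lemma pdh (hf : Smooth3 f) (a b : ℕ) : Smooth3 (pdh a b f) := by
  unfold _root_.pdh
  induction a with
  | zero => exact hf.pdy_iterate b
  | succ a ih => rw [Function.iterate_succ_apply']; exact ih.pdx

lemma pdx_pdh (a b : ℕ) : _root_.pdx (_root_.pdh a b f) = _root_.pdh (a + 1) b f := by
  simp only [_root_.pdh, Function.iterate_succ_apply']

lemma pdy_pdx_iterate (hf : Smooth3 f) (a : ℕ) :
    _root_.pdy (_root_.pdx^[a] f) = _root_.pdx^[a] (_root_.pdy f) := by
  induction a generalizing f with
  | zero => rfl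
  | succ a ih => rw [Function.iterate_succ_apply, ih hf.pdx, hf.pdy_pdx,
      Function.iterate_succ_apply]

lemma pdy_pdh (hf : Smooth3 f) (a b : ℕ) :
    _root_.pdy (_root_.pdh a b f) = _root_.pdh a (b + 1) f := by
  simp only [_root_.pdh]
  rw [(hf.pdy_iterate b).pdy_pdx_iterate, Function.iterate_succ_apply']

lemma add (hf : Smooth3 f) (hg : Smooth3 g) : Smooth3 fun x y z => f x y z + g x y z :=
  ContDiff.add hf hg

lemma mul (hf : Smooth3 f) (hg : Smooth3 g) : Smooth3 fun x y z => f x y z * g x y z :=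
  ContDiff.mul hf hg

lemma of_z {c : ℝ → ℝ} (hc : ContDiff ℝ (⊤ : ℕ∞) c) : Smooth3 fun _ _ z => c z :=
  hc.comp (contDiff_snd.comp contDiff_snd)

lemma coord_x : Smooth3 fun x _ _ => x := contDiff_fst

lemma coord_y : Smooth3 fun _ y _ => y := contDiff_fst.comp contDiff_snd

lemma continuous (hf : Smooth3 f) : Continuous (fun p : ℝ × ℝ × ℝ => f p.1 p.2.1 p.2.2) :=
  ContDiff.continuous hf

lemma continuous_z (hf : Smooth3 f) (x y : ℝ) : Continuous (f x y) :=
  hf.continuous.comp (by fun_prop : Continuous fun z : ℝ => (x, y, z))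

protected lemma rdr (hf : Smooth3 f) : Smooth3 (rdr f) :=
  (coord_x.mul hf.pdx).add (coord_y.mul hf.pdy)

end Smooth3

lemma hasDerivAt_intervalIntegral_param {F F' : ℝ → ℝ → ℝ}
    (hF : Continuous fun p : ℝ × ℝ => F p.1 p.2) (hF' : Continuous fun p : ℝ × ℝ => F' p.1 p.2)
    (hd : ∀ x s, HasDerivAt (fun x' => F x' s) (F' x s) x) (a b x : ℝ) :
    HasDerivAt (fun x' => ∫ s in a..b, F x' s) (∫ s in a..b, F' x s) x := by
  have hc : ∀ x, Continuous (F x) := fun x => hF.comp (by fun_prop : Continuous fun s => (x, s))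
  have hc' : ∀ x, Continuous (F' x) :=
    fun x => hF'.comp (by fun_prop : Continuous fun s => (x, s))
  obtain ⟨M, hM⟩ := ((isCompact_closedBall x 1).prod (isCompact_uIcc (a := a) (b := b))
    ).exists_bound_of_continuousOn hF'.continuousOn
  refine (intervalIntegral.hasDerivAt_integral_of_dominated_loc_of_deriv_le
    (s := Metric.closedBall x 1) (bound := fun _ => M) (Metric.closedBall_mem_nhds x one_pos)
    (Eventually.of_forall fun x' => (hc x').aestronglyMeasurable)
    ((hc x).intervalIntegrable _ _) ((hc' x).aestronglyMeasurable) ?_ (by simp) ?_).2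
  · refine Eventually.of_forall fun s hs x' hx' => ?_
    exact hM (x', s) ⟨hx', uIoc_subset_uIcc hs⟩
  · exact Eventually.of_forall fun s _ x' _ => hd x' s

section phi

variable {f g h k : ℝ → ℝ → ℝ → ℝ} {t : ℝ}

lemma hasDerivAt_phiF_x (hg : Smooth3 g) (t x y z : ℝ) :
    HasDerivAt (fun x' => phiF t g x' y z) (phiF t (pdx g) x y z) x := by
  unfold phiF
  refine HasDerivAt.const_mul _ (hasDerivAt_intervalIntegral_param
    (F := fun x s => g x y s * Real.exp (s ^ 2 / (4 * angT t)))
    (F' := fun x s => pdx g x y s * Real.exp (s ^ 2 / (4 * angT t))) ?_ ?_ ?_ 0 z x)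
  · have := hg.continuous.comp (by fun_prop : Continuous fun p : ℝ × ℝ => (p.1, y, p.2))
    exact this.mul (by fun_prop)
  · have := hg.pdx.continuous.comp (by fun_prop : Continuous fun p : ℝ × ℝ => (p.1, y, p.2))
    exact this.mul (by fun_prop)
  · exact fun x s => (hg.hasDerivAt_x x y s).mul_const _

lemma hasDerivAt_phiF_y (hg : Smooth3 g) (t x y z : ℝ) :
    HasDerivAt (fun y' => phiF t g x y' z) (phiF t (pdy g) x y z) y := by
  unfold phiF
  refine HasDerivAt.const_mul _ (hasDerivAt_intervalIntegral_param
    (F := fun y s => g x y s * Real.exp (s ^ 2 / (4 * angT t)))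
    (F' := fun y s => pdy g x y s * Real.exp (s ^ 2 / (4 * angT t))) ?_ ?_ ?_ 0 z y)
  · have := hg.continuous.comp (by fun_prop : Continuous fun p : ℝ × ℝ => (x, p.1, p.2))
    exact this.mul (by fun_prop)
  · have := hg.pdy.continuous.comp (by fun_prop : Continuous fun p : ℝ × ℝ => (x, p.1, p.2))
    exact this.mul (by fun_prop)
  · exact fun y s => (hg.hasDerivAt_y x y s).mul_const _

lemma continuous_phiF_integrand (hg : Smooth3 g) (t x y : ℝ) :
    Continuous fun s => g x y s * Real.exp (s ^ 2 / (4 * angT t)) :=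
  (hg.continuous_z x y).mul (by fun_prop)

lemma hasDerivAt_phiF_z (hg : Smooth3 g) (t x y z : ℝ) :
    HasDerivAt (fun z' => phiF t g x y z')
      (g x y z - z / (2 * angT t) * phiF t g x y z) z := by
  unfold phiF
  have h1 : HasDerivAt (fun z : ℝ => Real.exp (-(z ^ 2) / (4 * angT t)))
      (Real.exp (-(z ^ 2) / (4 * angT t)) * (-(2 * z) / (4 * angT t))) z := by
    have := (((hasDerivAt_pow 2 z).neg).div_const (4 * angT t)).exp
    simpa using this
  have h2 : HasDerivAt (fun z => ∫ s in (0 : ℝ)..z, g x y s * Real.exp (s ^ 2 / (4 * angT t)))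
      (g x y z * Real.exp (z ^ 2 / (4 * angT t))) z :=
    intervalIntegral.integral_hasDerivAt_right
      ((continuous_phiF_integrand hg t x y).intervalIntegrable _ _)
      (continuous_phiF_integrand hg t x y).stronglyMeasurable.stronglyMeasurableAtFilter
      (continuous_phiF_integrand hg t x y).continuousAt
  refine (h1.mul h2).congr_deriv ?_
  have h3 : Real.exp (-(z ^ 2) / (4 * angT t)) * (g x y z * Real.exp (z ^ 2 / (4 * angT t))) =
      g x y z := by
    rw [mul_left_comm, ← Real.exp_add, neg_div, neg_add_cancel, Real.exp_zero, mul_one]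
  rw [h3]
  rw [show -(2 * z) / (4 * angT t) = -(z / (2 * angT t)) by
    rw [show (4 : ℝ) * angT t = 2 * (2 * angT t) by ring, neg_div, mul_div_mul_left _ _ two_ne_zero]]
  ring

lemma ur_eq (hg : Smooth3 g) :
    ur t g = fun x y z => g x y z - z / (2 * angT t) * phiF t g x y z := by
  funext x y z
  exact (hasDerivAt_phiF_z hg t x y z).deriv

lemma phiF_add (hf : Smooth3 f) (hg : Smooth3 g) (x y z : ℝ) :
    phiF t (fun x y z => f x y z + g x y z) x y z = phiF t f x y z + phiF t g x y z := by
  simp only [phiF, add_mul]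
  rw [intervalIntegral.integral_add ((continuous_phiF_integrand hf t x y).intervalIntegrable _ _)
    ((continuous_phiF_integrand hg t x y).intervalIntegrable _ _), mul_add]

lemma phiF_const_mul (c x y z : ℝ) :
    phiF t (fun x' y' z' => c * g x' y' z') x y z = c * phiF t g x y z := by
  simp only [phiF, mul_assoc, intervalIntegral.integral_const_mul]
  ring

/-- `f + c(z) φ_h` -/
def addPhi (t : ℝ) (c : ℝ → ℝ) (f h : ℝ → ℝ → ℝ → ℝ) : ℝ → ℝ → ℝ → ℝ :=
  fun x y z => f x y z + c z * phiF t h x y z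

lemma hasDerivAt_addPhi_x (c : ℝ → ℝ) (hf : Smooth3 f) (hh : Smooth3 h) (x y z : ℝ) :
    HasDerivAt (fun x' => addPhi t c f h x' y z) (addPhi t c (pdx f) (pdx h) x y z) x :=
  (hf.hasDerivAt_x x y z).add ((hasDerivAt_phiF_x hh t x y z).const_mul _)

lemma hasDerivAt_addPhi_y (c : ℝ → ℝ) (hf : Smooth3 f) (hh : Smooth3 h) (x y z : ℝ) :
    HasDerivAt (fun y' => addPhi t c f h x y' z) (addPhi t c (pdy f) (pdy h) x y z) y :=
  (hf.hasDerivAt_y x y z).add ((hasDerivAt_phiF_y hh t x y z).const_mul _)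

lemma pdx_addPhi (c : ℝ → ℝ) (hf : Smooth3 f) (hh : Smooth3 h) :
    pdx (addPhi t c f h) = addPhi t c (pdx f) (pdx h) := by
  funext x y z
  exact (hasDerivAt_addPhi_x c hf hh x y z).deriv

lemma pdy_addPhi (c : ℝ → ℝ) (hf : Smooth3 f) (hh : Smooth3 h) :
    pdy (addPhi t c f h) = addPhi t c (pdy f) (pdy h) := by
  funext x y z
  exact (hasDerivAt_addPhi_y c hf hh x y z).deriv

/-- `∂_z u^r = (∂_z g - z/(2⟨t⟩) g) + (z²/(4⟨t⟩²) - 1/(2⟨t⟩)) φ` -/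
lemma pdz_ur_eq (hg : Smooth3 g) :
    pdz (ur t g) = addPhi t (fun z => (z / (2 * angT t)) ^ 2 - 1 / (2 * angT t))
      (fun x y z => 1 * pdz g x y z + (-(z / (2 * angT t))) * g x y z) g := by
  funext x y z
  rw [ur_eq hg]
  have h1 := (hg.hasDerivAt_z x y z).sub
    ((((hasDerivAt_id z).div_const (2 * angT t))).mul (hasDerivAt_phiF_z hg t x y z))
  refine h1.deriv.trans ?_
  simp only [addPhi, id]
  ring

/-- `u^z = φ_{-(r∂_r g) - 2g}` -/
lemma uzv_eq (hg : Smooth3 g) :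
    uzv t g = addPhi t (fun _ => 1) (fun _ _ _ => 0)
      (fun x y z => (-1) * rdr g x y z + (-2) * g x y z) := by
  funext x y z
  have hc : ∀ c : ℝ, Smooth3 fun _ _ _ => c := fun c => contDiff_const
  have e1 := phiF_add (t := t) ((hc (-1)).mul hg.rdr) ((hc (-2)).mul hg) x y z
  simp only [addPhi, zero_add, one_mul]
  rw [e1, phiF_const_mul, phiF_const_mul]
  have e2 : phiF t (rdr g) x y z = rdr (phiF t g) x y z := by
    have e3 := phiF_add (t := t) (Smooth3.coord_x.mul hg.pdx) (Smooth3.coord_y.mul hg.pdy) x y z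
    refine e3.trans ?_
    have e4 : phiF t (fun x y z => x * pdx g x y z) x y z = x * phiF t (pdx g) x y z :=
      phiF_const_mul x x y z
    have e5 : phiF t (fun x y z => y * pdy g x y z) x y z = y * phiF t (pdy g) x y z :=
      phiF_const_mul y x y z
    rw [e4, e5]
    simp only [rdr]
    rw [show pdx (phiF t g) x y z = _ from (hasDerivAt_phiF_x hg t x y z).deriv,
      show pdy (phiF t g) x y z = _ from (hasDerivAt_phiF_y hg t x y z).deriv]
  rw [e2, uzv]
  ring

lemma pdy_iterate_addPhi (c : ℝ → ℝ) (hf : Smooth3 f) (hh : Smooth3 h) (b : ℕ) :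
    pdy^[b] (addPhi t c f h) = addPhi t c (pdy^[b] f) (pdy^[b] h) := by
  induction b with
  | zero => rfl
  | succ b ih =>
    rw [Function.iterate_succ_apply', ih, pdy_addPhi c (hf.pdy_iterate b) (hh.pdy_iterate b),
      Function.iterate_succ_apply', Function.iterate_succ_apply']

lemma pdh_addPhi (c : ℝ → ℝ) (hf : Smooth3 f) (hh : Smooth3 h) (a b : ℕ) :
    pdh a b (addPhi t c f h) = addPhi t c (pdh a b f) (pdh a b h) := by
  induction a with
  | zero => exact pdy_iterate_addPhi c hf hh b
  | succ a ih =>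
    rw [← Smooth3.pdx_pdh, ih, pdx_addPhi c (hf.pdh a b) (hh.pdh a b), Smooth3.pdx_pdh,
      Smooth3.pdx_pdh]

end phi

section leibniz

open Finset in
lemma hasDerivAt_leibniz_sum {u v : ℕ → ℝ → ℝ} {x : ℝ}
    (hu : ∀ k, HasDerivAt (u k) (u (k + 1) x) x) (hv : ∀ k, HasDerivAt (v k) (v (k + 1) x) x)
    (n : ℕ) :
    HasDerivAt (fun x' => ∑ p ∈ antidiagonal n, (n.choose p.1 : ℝ) * (u p.1 x' * v p.2 x'))
      (∑ p ∈ antidiagonal (n + 1), ((n + 1).choose p.1 : ℝ) * (u p.1 x * v p.2 x)) x := by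
  have h := HasDerivAt.fun_sum (u := antidiagonal n) (x := x)
    (A := fun p x' => (n.choose p.1 : ℝ) * (u p.1 x' * v p.2 x'))
    (A' := fun p => (n.choose p.1 : ℝ) * (u (p.1 + 1) x * v p.2 x + u p.1 x * v (p.2 + 1) x))
    (fun p _ => ((hu p.1).mul (hv p.2)).const_mul _)
  refine h.congr_deriv ?_
  rw [Finset.sum_antidiagonal_choose_succ_mul (fun i j => u i x * v j x) n, ← sum_add_distrib]
  refine sum_congr rfl fun p hp => ?_
  rw [Nat.choose_symm_of_eq_add (mem_antidiagonal.1 hp).symm]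
  ring

/-- all mixed horizontal derivatives exist -/
def HDiff (f : ℝ → ℝ → ℝ → ℝ) : Prop :=
  (∀ k x y z, HasDerivAt (fun y' => pdy^[k] f x y' z) (pdy^[k + 1] f x y z) y) ∧
  ∀ i k x y z, HasDerivAt (fun x' => pdh i k f x' y z) (pdh (i + 1) k f x y z) x

variable {f g h : ℝ → ℝ → ℝ → ℝ} {t : ℝ}

open Finset in
lemma pdy_iterate_mul (hf : HDiff f) (hg : HDiff g) (b : ℕ) :
    pdy^[b] (fun x y z => f x y z * g x y z) = fun x y z =>
      ∑ p ∈ antidiagonal b, (b.choose p.1 : ℝ) * (pdy^[p.1] f x y z * pdy^[p.2] g x y z) := by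
  induction b with
  | zero => funext x y z; simp
  | succ b ih =>
    rw [Function.iterate_succ_apply', ih]
    funext x y z
    exact (hasDerivAt_leibniz_sum (u := fun k y' => pdy^[k] f x y' z)
      (v := fun k y' => pdy^[k] g x y' z) (fun k => hf.1 k x y z) (fun k => hg.1 k x y z) b).deriv

open Finset in
/-- the Leibniz rule for horizontal derivatives -/
lemma pdh_mul (hf : HDiff f) (hg : HDiff g) (a b : ℕ) :
    pdh a b (fun x y z => f x y z * g x y z) = fun x y z =>
      ∑ q ∈ antidiagonal b, (b.choose q.1 : ℝ) * ∑ p ∈ antidiagonal a, (a.choose p.1 : ℝ) *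
        (pdh p.1 q.1 f x y z * pdh p.2 q.2 g x y z) := by
  induction a with
  | zero =>
    funext x y z
    simp only [pdh, Function.iterate_zero, id, pdy_iterate_mul hf hg]
    simp
  | succ a ih =>
    rw [← Smooth3.pdx_pdh, ih]
    funext x y z
    exact (HasDerivAt.fun_sum fun q _ => (hasDerivAt_leibniz_sum
      (u := fun k x' => pdh k q.1 f x' y z) (v := fun k x' => pdh k q.2 g x' y z)
      (fun k => hf.2 k q.1 x y z) (fun k => hg.2 k q.2 x y z) a).const_mul _).deriv

lemma HDiff.addPhi (c : ℝ → ℝ) (hf : Smooth3 f) (hh : Smooth3 h) : HDiff (addPhi t c f h) := by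
  constructor
  · intro k x y z
    rw [pdy_iterate_addPhi c hf hh, pdy_iterate_addPhi c hf hh]
    have := hasDerivAt_addPhi_y (t := t) c (hf.pdy_iterate k) (hh.pdy_iterate k) x y z
    simpa only [← Function.iterate_succ_apply' (f := pdy)] using this
  · intro i k x y z
    rw [pdh_addPhi c hf hh, pdh_addPhi c hf hh]
    have := hasDerivAt_addPhi_x (t := t) c (hf.pdh i k) (hh.pdh i k) x y z
    simpa only [Smooth3.pdx_pdh] using this

lemma pdx_linear_comb (c d : ℝ → ℝ) (hf : Smooth3 f) (hg : Smooth3 g) :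
    pdx (fun x y z => c z * f x y z + d z * g x y z) =
      fun x y z => c z * pdx f x y z + d z * pdx g x y z := by
  funext x y z
  exact (((hf.hasDerivAt_x x y z).const_mul _).add ((hg.hasDerivAt_x x y z).const_mul _)).deriv

lemma pdy_linear_comb (c d : ℝ → ℝ) (hf : Smooth3 f) (hg : Smooth3 g) :
    pdy (fun x y z => c z * f x y z + d z * g x y z) =
      fun x y z => c z * pdy f x y z + d z * pdy g x y z := by
  funext x y z
  exact (((hf.hasDerivAt_y x y z).const_mul _).add ((hg.hasDerivAt_y x y z).const_mul _)).deriv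

lemma pdh_linear_comb (c d : ℝ → ℝ) (hf : Smooth3 f) (hg : Smooth3 g) (a b : ℕ) :
    pdh a b (fun x y z => c z * f x y z + d z * g x y z) =
      fun x y z => c z * pdh a b f x y z + d z * pdh a b g x y z := by
  induction a with
  | zero =>
    simp only [pdh, Function.iterate_zero, id]
    induction b with
    | zero => rfl
    | succ b ih =>
      rw [Function.iterate_succ_apply', ih,
        pdy_linear_comb c d (hf.pdy_iterate b) (hg.pdy_iterate b)]
      simp only [← Function.iterate_succ_apply' (f := pdy)]
  | succ a ih =>
    rw [← Smooth3.pdx_pdh, ih, pdx_linear_comb c d (hf.pdh a b) (hg.pdh a b)]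
    simp only [Smooth3.pdx_pdh]

lemma pdx_rdr (hg : Smooth3 g) :
    pdx (rdr g) = fun x y z => 1 * rdr (pdx g) x y z + 1 * pdx g x y z := by
  funext x y z
  have h1 := ((hasDerivAt_id x).mul (hg.pdx.hasDerivAt_x x y z)).add
    ((hg.pdy.hasDerivAt_x x y z).const_mul y)
  refine h1.deriv.trans ?_
  simp only [rdr, hg.pdy_pdx, id]
  ring

lemma pdy_rdr (hg : Smooth3 g) :
    pdy (rdr g) = fun x y z => 1 * rdr (pdy g) x y z + 1 * pdy g x y z := by
  funext x y z
  have h1 := ((hg.pdx.hasDerivAt_y x y z).const_mul x).add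
    ((hasDerivAt_id y).mul (hg.pdy.hasDerivAt_y x y z))
  refine h1.deriv.trans ?_
  simp only [rdr, hg.pdy_pdx, id]
  ring

lemma pdh_rdr (hg : Smooth3 g) (a b : ℕ) :
    pdh a b (rdr g) = fun x y z => 1 * rdr (pdh a b g) x y z + (a + b : ℝ) * pdh a b g x y z := by
  induction a with
  | zero =>
    simp only [pdh, Function.iterate_zero, id]
    induction b with
    | zero => funext x y z; simp
    | succ b ih =>
      rw [Function.iterate_succ_apply', ih]
      rw [pdy_linear_comb (fun _ => 1) (fun _ => ((0 : ℕ) + b : ℝ)) (hg.pdy_iterate b).rdr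
        (hg.pdy_iterate b), pdy_rdr (hg.pdy_iterate b)]
      simp only [← Function.iterate_succ_apply' (f := pdy)]
      funext x y z
      push_cast
      ring
  | succ a ih =>
    rw [← Smooth3.pdx_pdh, ih]
    rw [pdx_linear_comb (fun _ => 1) (fun _ => (a + b : ℝ)) (hg.pdh a b).rdr
        (hg.pdh a b), pdx_rdr (hg.pdh a b)]
    simp only [Smooth3.pdx_pdh]
    funext x y z
    push_cast
    ring

/-- horizontal derivatives of `∂_z u^r` -/
lemma pdh_pdz_ur (hg : Smooth3 g) (a b : ℕ) (x y z : ℝ) :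
    pdh a b (pdz (ur t g)) x y z = pdh a b (pdz g) x y z
      - z / (2 * angT t) * pdh a b g x y z
      + ((z / (2 * angT t)) ^ 2 - 1 / (2 * angT t)) * phiF t (pdh a b g) x y z := by
  have hs : Smooth3 fun x y z => 1 * pdz g x y z + (-(z / (2 * angT t))) * g x y z :=
    ((Smooth3.of_z (c := fun _ => 1) contDiff_const).mul hg.pdz).add
      ((Smooth3.of_z (c := fun z => -(z / (2 * angT t))) (by fun_prop)).mul hg)
  rw [pdz_ur_eq hg, pdh_addPhi _ hs hg]
  rw [pdh_linear_comb (fun _ => 1) (fun z => -(z / (2 * angT t))) hg.pdz hg]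
  simp only [addPhi]
  ring

/-- horizontal derivatives of `u^z` -/
lemma pdh_uzv (hg : Smooth3 g) (a b : ℕ) (x y z : ℝ) :
    pdh a b (uzv t g) x y z = -(x * phiF t (pdh (a + 1) b g) x y z
      + y * phiF t (pdh a (b + 1) g) x y z + (a + b + 2 : ℝ) * phiF t (pdh a b g) x y z) := by
  have hc : ∀ c : ℝ, Smooth3 fun _ _ _ => c := fun c => contDiff_const
  have hs : Smooth3 fun x y z => (-1) * rdr g x y z + (-2) * g x y z :=
    ((hc _).mul hg.rdr).add ((hc _).mul hg)
  rw [uzv_eq hg, pdh_addPhi _ (hc 0) hs]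
  have h0 : pdh a b (fun _ _ _ => (0 : ℝ)) = fun _ _ _ => 0 := by
    have := pdh_linear_comb (fun _ => 0) (fun _ => 0) (hc 0) (hc 0) a b
    simpa using this
  rw [h0, pdh_linear_comb (fun _ => -1) (fun _ => -2) hg.rdr hg, pdh_rdr hg]
  simp only [addPhi, zero_add, one_mul]
  have e : (fun x y z => -1 * (rdr (pdh a b g) x y z + (a + b : ℝ) * pdh a b g x y z)
      + -2 * pdh a b g x y z) = fun x y z =>
      (-x * pdh (a + 1) b g x y z + -y * pdh a (b + 1) g x y z) +
        -(a + b + 2 : ℝ) * pdh a b g x y z := by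
    funext x y z
    rw [← Smooth3.pdx_pdh, ← hg.pdy_pdh, rdr]
    ring
  rw [e]
  have hx : Smooth3 fun x y z => -x * pdh (a + 1) b g x y z :=
    (ContDiff.neg Smooth3.coord_x).mul (hg.pdh _ _)
  have hy : Smooth3 fun x y z => -y * pdh a (b + 1) g x y z :=
    (ContDiff.neg Smooth3.coord_y).mul (hg.pdh _ _)
  have e1 := phiF_add (t := t) (hx.add hy) ((hc (-(a + b + 2 : ℝ))).mul (hg.pdh a b)) x y z
  rw [e1, phiF_add hx hy, phiF_const_mul]
  have e4 : phiF t (fun x y z => -x * pdh (a + 1) b g x y z) x y z =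
      -x * phiF t (pdh (a + 1) b g) x y z := phiF_const_mul (-x) x y z
  have e5 : phiF t (fun x y z => -y * pdh a (b + 1) g x y z) x y z =
      -y * phiF t (pdh a (b + 1) g) x y z := phiF_const_mul (-y) x y z
  rw [e4, e5]
  ring

open Finset in
/-- the Leibniz expansion of `∂^α_h (∂_z u^r u^z)` -/
lemma pdh_pdz_ur_mul_uzv (hg : Smooth3 g) (a b : ℕ) (x y z : ℝ) :
    pdh a b (fun x' y' z' => pdz (ur t g) x' y' z' * uzv t g x' y' z') x y z =
      ∑ q ∈ antidiagonal b, (b.choose q.1 : ℝ) * ∑ p ∈ antidiagonal a, (a.choose p.1 : ℝ) *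
        (pdh p.1 q.1 (pdz (ur t g)) x y z * pdh p.2 q.2 (uzv t g) x y z) := by
  have hc : ∀ c : ℝ, Smooth3 fun _ _ _ => c := fun c => contDiff_const
  refine congrFun (congrFun (congrFun (pdh_mul ?_ ?_ a b) x) y) z
  · rw [pdz_ur_eq hg]
    exact HDiff.addPhi _ (((hc 1).mul hg.pdz).add
      ((Smooth3.of_z (c := fun z => -(z / (2 * angT t))) (by fun_prop)).mul hg)) hg
  · rw [uzv_eq hg]
    exact HDiff.addPhi _ (hc 0) (((hc (-1)).mul hg.rdr).add ((hc (-2)).mul hg))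

end leibniz

section

open scoped ENNReal

section l2

variable {α : Type*} [MeasurableSpace α] {μ : Measure α} {f g : α → ℝ≥0∞}

/-- the `L²` norm of an extended nonnegative function -/
def l2 (μ : Measure α) (f : α → ℝ≥0∞) : ℝ≥0∞ := (∫⁻ a, f a ^ (2 : ℝ) ∂μ) ^ (1 / 2 : ℝ)

lemma l2_sq (μ : Measure α) (f : α → ℝ≥0∞) : l2 μ f ^ 2 = ∫⁻ a, f a ^ 2 ∂μ := by
  rw [l2, ← ENNReal.rpow_two, ← ENNReal.rpow_mul]
  simp

lemma l2_le_of_sq_le {c : ℝ≥0∞} (h : ∫⁻ a, f a ^ 2 ∂μ ≤ c ^ 2) : l2 μ f ≤ c := by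
  rw [← l2_sq] at h
  exact (ENNReal.pow_le_pow_left_iff two_ne_zero).1 h

lemma lintegral_mul_le_l2 (hf : AEMeasurable f μ) (hg : AEMeasurable g μ) :
    ∫⁻ a, f a * g a ∂μ ≤ l2 μ f * l2 μ g :=
  ENNReal.lintegral_mul_le_Lp_mul_Lq μ Real.HolderConjugate.two_two hf hg

lemma l2_mono (h : ∀ a, f a ≤ g a) : l2 μ f ≤ l2 μ g := by
  refine l2_le_of_sq_le ?_
  rw [l2_sq]
  exact lintegral_mono fun a => pow_le_pow_left' (h a) 2

lemma l2_const_mul_le (c : ℝ≥0∞) (hf : AEMeasurable f μ) : l2 μ (fun a => c * f a) ≤ c * l2 μ f := by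
  refine l2_le_of_sq_le ?_
  simp only [mul_pow, l2_sq]
  rw [lintegral_const_mul'' _ (hf.pow_const 2)]

lemma l2_add_le (hf : AEMeasurable f μ) (hg : AEMeasurable g μ) :
    l2 μ (fun a => f a + g a) ≤ l2 μ f + l2 μ g :=
  ENNReal.lintegral_Lp_add_le hf hg one_le_two

end l2

section gaussian

variable {t σ : ℝ}

lemma thw_add (t l m z : ℝ) : thw t (l + m) z = thw t l z * thw t m z := by
  simp only [thw, ← Real.exp_add]
  congr 1
  ring

lemma thw_pos (t l z : ℝ) : 0 < thw t l z := Real.exp_pos _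

lemma thw_mono_left (hw : angT t = σ ^ 4) {l m : ℝ} (h : l ≤ m) (z : ℝ) :
    thw t l z ≤ thw t m z := by
  rw [thw, thw, hw]
  gcongr

lemma thw_sq (t l z : ℝ) : thw t l z ^ 2 = thw t (2 * l) z := by
  rw [two_mul, thw_add, sq]

@[fun_prop]
lemma continuous_thw (t l : ℝ) : Continuous (thw t l) := by
  unfold thw
  fun_prop

lemma sq_le_mul_thw (hσ : 0 < σ) (hw : angT t = σ ^ 4) {l : ℝ} (hl : 0 < l) (z : ℝ) :
    z ^ 2 ≤ 8 / l * σ ^ 4 * thw t l z := by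
  have h := Real.add_one_le_exp (l * z ^ 2 / (8 * angT t))
  have h' : l * z ^ 2 / (8 * σ ^ 4) ≤ thw t l z := by
    rw [thw, ← hw]; linarith
  rw [div_le_iff₀ (by positivity)] at h'
  have e : 8 / l * σ ^ 4 * thw t l z = thw t l z * (8 * σ ^ 4) / l := by ring
  rw [e, le_div_iff₀ hl]
  linarith

lemma self_le_mul_thw (hσ : 0 < σ) (hw : angT t = σ ^ 4) (z : ℝ) :
    z ≤ 4 * σ ^ 2 * thw t (1 / 4) z := by
  refine abs_le_of_sq_le_sq' ?_ (by have := thw_pos t (1 / 4) z; positivity) |>.2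
  have h := sq_le_mul_thw hσ hw (l := 1 / 2) (by norm_num) z
  rw [mul_pow, thw_sq]
  norm_num at h ⊢
  linarith

lemma lintegral_gaussian {b : ℝ} (hb : 0 < b) :
    ∫⁻ s : ℝ, ENNReal.ofReal (Real.exp (-b * s ^ 2)) = ENNReal.ofReal (√(Real.pi / b)) := by
  rw [← integral_gaussian, ofReal_integral_eq_lintegral_ofReal (integrable_exp_neg_mul_sq hb)]
  exact Eventually.of_forall fun s => (Real.exp_pos _).le

lemma lintegral_thw_neg_le (hσ : 0 < σ) (hw : angT t = σ ^ 4) {k : ℝ} (hk : 1 / 4 ≤ k) :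
    ∫⁻ s in Ioi (0 : ℝ), ENNReal.ofReal (thw t (-k) s) ≤ ENNReal.ofReal (11 * σ ^ 2) := by
  calc ∫⁻ s in Ioi (0 : ℝ), ENNReal.ofReal (thw t (-k) s)
      ≤ ∫⁻ s, ENNReal.ofReal (thw t (-k) s) := setLIntegral_le_lintegral _ _
    _ ≤ ∫⁻ s : ℝ, ENNReal.ofReal (Real.exp (-(1 / (32 * σ ^ 4)) * s ^ 2)) := by
        refine lintegral_mono fun s => ENNReal.ofReal_le_ofReal ?_
        refine (thw_mono_left hw (neg_le_neg hk) s).trans_eq ?_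
        rw [thw, hw]
        congr 1
        field_simp
        ring
    _ = ENNReal.ofReal (√(Real.pi / (1 / (32 * σ ^ 4)))) := lintegral_gaussian (by positivity)
    _ ≤ _ := by
        refine ENNReal.ofReal_le_ofReal (Real.sqrt_le_iff.2 ⟨by positivity, ?_⟩)
        have := Real.pi_lt_d2
        rw [div_div_eq_mul_div, div_one]
        nlinarith [pow_pos hσ 4]

end gaussian

section vertical

variable {g : ℝ → ℝ → ℝ → ℝ} {t σ : ℝ}

/-- the `L²_z` norm of `θ g (x, y, ·)` as an extended nonnegative number -/
def vert (t : ℝ) (g : ℝ → ℝ → ℝ → ℝ) (x y : ℝ) : ℝ≥0∞ :=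
  l2 (volume.restrict (Ioi (0 : ℝ))) fun z => ‖thw t 1 z * g x y z‖ₑ

lemma enorm_phiF_le (hg : Smooth3 g) (hσ : 0 < σ) (hw : angT t = σ ^ 4) (x y : ℝ) {z : ℝ}
    (hz : 0 < z) :
    ‖phiF t g x y z‖ₑ ≤ ENNReal.ofReal (2 * σ * thw t (-1) z) * vert t g x y := by
  have hcont := hg.continuous_z x y
  have h1 : l2 (volume.restrict (Ioi (0 : ℝ)))
      (fun s => ENNReal.ofReal (Real.exp (-(1 / (8 * σ ^ 4)) * (s - z) ^ 2)))
      ≤ ENNReal.ofReal (2 * σ) := by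
    refine l2_le_of_sq_le ?_
    calc ∫⁻ s in Ioi (0 : ℝ), ENNReal.ofReal (Real.exp (-(1 / (8 * σ ^ 4)) * (s - z) ^ 2)) ^ 2
        ≤ ∫⁻ s : ℝ, ENNReal.ofReal (Real.exp (-(1 / (8 * σ ^ 4)) * (s - z) ^ 2)) ^ 2 :=
          setLIntegral_le_lintegral _ _
      _ = ∫⁻ s : ℝ, ENNReal.ofReal (Real.exp (-(1 / (4 * σ ^ 4)) * (s - z) ^ 2)) := by
          refine lintegral_congr fun s => ?_
          rw [← ENNReal.ofReal_pow (Real.exp_pos _).le, ← Real.exp_nat_mul]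
          congr 2
          field_simp
          ring
      _ = ∫⁻ s : ℝ, ENNReal.ofReal (Real.exp (-(1 / (4 * σ ^ 4)) * s ^ 2)) :=
          lintegral_sub_right_eq_self
            (fun s : ℝ => ENNReal.ofReal (Real.exp (-(1 / (4 * σ ^ 4)) * s ^ 2))) z
      _ = ENNReal.ofReal (√(Real.pi / (1 / (4 * σ ^ 4)))) := lintegral_gaussian (by positivity)
      _ ≤ ENNReal.ofReal (2 * σ) ^ 2 := by
          rw [← ENNReal.ofReal_pow (by positivity)]
          refine ENNReal.ofReal_le_ofReal (Real.sqrt_le_iff.2 ⟨by positivity, ?_⟩)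
          have := Real.pi_lt_d2
          rw [div_div_eq_mul_div, div_one]
          nlinarith [pow_pos hσ 4]
  calc ‖phiF t g x y z‖ₑ
      ≤ ‖Real.exp (-(z ^ 2) / (4 * angT t))‖ₑ *
          ∫⁻ s in Ioc 0 z, ‖g x y s * Real.exp (s ^ 2 / (4 * angT t))‖ₑ := by
        rw [phiF, enorm_mul, intervalIntegral.integral_of_le hz.le]
        gcongr
        exact enorm_integral_le_lintegral_enorm _
    _ = ∫⁻ s in Ioc 0 z, ‖Real.exp (-(z ^ 2) / (4 * angT t))‖ₑ *
          ‖g x y s * Real.exp (s ^ 2 / (4 * angT t))‖ₑ := by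
        rw [lintegral_const_mul' _ _ enorm_ne_top]
    _ ≤ ∫⁻ s in Ioc 0 z, ENNReal.ofReal (thw t (-1) z) * (‖thw t 1 s * g x y s‖ₑ *
          ENNReal.ofReal (Real.exp (-(1 / (8 * σ ^ 4)) * (s - z) ^ 2))) := by
        refine setLIntegral_mono' measurableSet_Ioc fun s hs => ?_
        rw [← enorm_mul, ← Real.enorm_of_nonneg (thw_pos t (-1) z).le,
          ← Real.enorm_of_nonneg (Real.exp_pos (-(1 / (8 * σ ^ 4)) * (s - z) ^ 2)).le,
          ← enorm_mul, ← enorm_mul]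
        rw [Real.enorm_eq_ofReal_abs, Real.enorm_eq_ofReal_abs]
        refine ENNReal.ofReal_le_ofReal ?_
        simp only [abs_mul, thw, Real.abs_exp]
        have e : Real.exp (-(z ^ 2) / (4 * angT t)) * Real.exp (s ^ 2 / (4 * angT t)) ≤
            Real.exp (-1 * z ^ 2 / (8 * angT t)) * (Real.exp (1 * s ^ 2 / (8 * angT t)) *
              Real.exp (-(1 / (8 * σ ^ 4)) * (s - z) ^ 2)) := by
          rw [← Real.exp_add, ← Real.exp_add, ← Real.exp_add, hw]
          refine Real.exp_le_exp.2 ?_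
          have : 0 < σ ^ 4 := by positivity
          field_simp
          nlinarith [hs.1, hs.2]
        calc _ = Real.exp (-(z ^ 2) / (4 * angT t)) * Real.exp (s ^ 2 / (4 * angT t)) *
              |g x y s| := by ring
          _ ≤ _ := mul_le_mul_of_nonneg_right e (abs_nonneg _)
          _ = _ := by ring
    _ ≤ ∫⁻ s in Ioi 0, ENNReal.ofReal (thw t (-1) z) * (‖thw t 1 s * g x y s‖ₑ *
          ENNReal.ofReal (Real.exp (-(1 / (8 * σ ^ 4)) * (s - z) ^ 2))) :=
        lintegral_mono_set Ioc_subset_Ioi_self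
    _ = ENNReal.ofReal (thw t (-1) z) * ∫⁻ s in Ioi 0, (‖thw t 1 s * g x y s‖ₑ *
          ENNReal.ofReal (Real.exp (-(1 / (8 * σ ^ 4)) * (s - z) ^ 2))) := by
        rw [lintegral_const_mul' _ _ ENNReal.ofReal_ne_top]
    _ ≤ ENNReal.ofReal (thw t (-1) z) * (vert t g x y * ENNReal.ofReal (2 * σ)) := by
        gcongr
        refine (lintegral_mul_le_l2 ?_ ?_).trans (mul_le_mul_right h1 _)
        · exact (((continuous_thw t 1).mul hcont).measurable.enorm).aemeasurable
        · exact (by fun_prop : Measurable fun s : ℝ =>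
            ENNReal.ofReal (Real.exp (-(1 / (8 * σ ^ 4)) * (s - z) ^ 2))).aemeasurable
    _ = _ := by
        rw [ENNReal.ofReal_mul (by positivity : (0 : ℝ) ≤ 2 * σ)]
        ring

lemma lintegral_thw_mul_le (hg : Smooth3 g) (hσ : 0 < σ) (hw : angT t = σ ^ 4) (x y : ℝ) :
    ∫⁻ s in Ioi (0 : ℝ), ENNReal.ofReal (thw t (3 / 4) s) * ‖g x y s‖ₑ ≤
      ENNReal.ofReal (4 * σ) * vert t g x y := by
  have hcont := hg.continuous_z x y
  calc ∫⁻ s in Ioi (0 : ℝ), ENNReal.ofReal (thw t (3 / 4) s) * ‖g x y s‖ₑ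
      = ∫⁻ s in Ioi (0 : ℝ), ENNReal.ofReal (thw t (-(1 / 4)) s) * ‖thw t 1 s * g x y s‖ₑ := by
        refine lintegral_congr fun s => ?_
        rw [enorm_mul, Real.enorm_of_nonneg (thw_pos t 1 s).le, ← mul_assoc,
          ← ENNReal.ofReal_mul (thw_pos _ _ _).le, ← thw_add]
        norm_num
    _ ≤ l2 (volume.restrict (Ioi (0 : ℝ))) (fun s => ENNReal.ofReal (thw t (-(1 / 4)) s)) *
        vert t g x y := by
        refine lintegral_mul_le_l2 ?_ ?_
        · exact ((continuous_thw t _).measurable.ennreal_ofReal).aemeasurable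
        · exact (((continuous_thw t 1).mul hcont).measurable.enorm).aemeasurable
    _ ≤ _ := by
        gcongr
        refine l2_le_of_sq_le ?_
        calc ∫⁻ s in Ioi (0 : ℝ), ENNReal.ofReal (thw t (-(1 / 4)) s) ^ 2
            = ∫⁻ s in Ioi (0 : ℝ), ENNReal.ofReal (thw t (-(1 / 2)) s) := by
              refine lintegral_congr fun s => ?_
              rw [← ENNReal.ofReal_pow (thw_pos _ _ _).le, thw_sq]
              norm_num
          _ ≤ ENNReal.ofReal (11 * σ ^ 2) := lintegral_thw_neg_le hσ hw (by norm_num)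
          _ ≤ ENNReal.ofReal (4 * σ) ^ 2 := by
              rw [← ENNReal.ofReal_pow (by positivity)]
              refine ENNReal.ofReal_le_ofReal ?_
              nlinarith [pow_pos hσ 2]

end vertical

section vertical

variable {g : ℝ → ℝ → ℝ → ℝ} {t σ : ℝ}

/-- bound for the `L²_z` size of `∂^α_h ∂_z u^r` -/
def vertF (t σ : ℝ) (g : ℝ → ℝ → ℝ → ℝ) (a b : ℕ) (x y : ℝ) : ℝ≥0∞ :=
  ENNReal.ofReal σ * vert t (pdh a b (pdz g)) x y + ENNReal.ofReal σ⁻¹ * vert t (pdh a b g) x y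

/-- bound for the size of `∂^α_h u^z` -/
def vertU (t : ℝ) (g : ℝ → ℝ → ℝ → ℝ) (a b : ℕ) (x y : ℝ) : ℝ≥0∞ :=
  ENNReal.ofReal (angR x y) * vert t (pdh (a + 1) b g) x y +
    ENNReal.ofReal (angR x y) * vert t (pdh a (b + 1) g) x y +
    ENNReal.ofReal (a + b + 2) * vert t (pdh a b g) x y

lemma angR_pos (x y : ℝ) : 0 < angR x y := Real.sqrt_pos.2 (by positivity)

lemma abs_fst_le_angR (x y : ℝ) : |x| ≤ angR x y :=
  Real.abs_le_sqrt (by nlinarith [sq_nonneg y])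

lemma abs_snd_le_angR (x y : ℝ) : |y| ≤ angR x y :=
  Real.abs_le_sqrt (by nlinarith [sq_nonneg x])

lemma enorm_mul_eq (a b : ℝ) : ‖a * b‖ₑ = ENNReal.ofReal |a| * ‖b‖ₑ := by
  rw [enorm_mul, Real.enorm_eq_ofReal_abs a]

lemma enorm_pdh_uzv_le (hg : Smooth3 g) (hσ : 0 < σ) (hw : angT t = σ ^ 4) (a b : ℕ) (x y : ℝ)
    {z : ℝ} (hz : 0 < z) :
    ‖pdh a b (uzv t g) x y z‖ₑ ≤
      ENNReal.ofReal (2 * σ * thw t (-1) z) * vertU t g a b x y := by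
  rw [pdh_uzv hg, enorm_neg]
  calc _ ≤ ‖x * phiF t (pdh (a + 1) b g) x y z‖ₑ + ‖y * phiF t (pdh a (b + 1) g) x y z‖ₑ +
        ‖(a + b + 2 : ℝ) * phiF t (pdh a b g) x y z‖ₑ :=
      (enorm_add_le _ _).trans (add_le_add_left (enorm_add_le _ _) _)
    _ ≤ ENNReal.ofReal (angR x y) *
          (ENNReal.ofReal (2 * σ * thw t (-1) z) * vert t (pdh (a + 1) b g) x y) +
        ENNReal.ofReal (angR x y) *
          (ENNReal.ofReal (2 * σ * thw t (-1) z) * vert t (pdh a (b + 1) g) x y) +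
        ENNReal.ofReal (a + b + 2) *
          (ENNReal.ofReal (2 * σ * thw t (-1) z) * vert t (pdh a b g) x y) := by
      rw [enorm_mul_eq, enorm_mul_eq, enorm_mul_eq, abs_of_nonneg (by positivity : (0 : ℝ) ≤ a + b + 2)]
      gcongr
      · exact abs_fst_le_angR x y
      · exact enorm_phiF_le (hg.pdh _ _) hσ hw x y hz
      · exact abs_snd_le_angR x y
      · exact enorm_phiF_le (hg.pdh _ _) hσ hw x y hz
      · exact enorm_phiF_le (hg.pdh _ _) hσ hw x y hz
    _ = _ := by rw [vertU]; ring

lemma one_le_thw (hw : angT t = σ ^ 4) {l : ℝ} (hl : 0 ≤ l) (z : ℝ) : 1 ≤ thw t l z := by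
  rw [thw, hw]
  exact Real.one_le_exp (by positivity)

lemma continuous_phiF_z (hg : Smooth3 g) (x y : ℝ) : Continuous fun z => phiF t g x y z :=
  continuous_iff_continuousAt.2 fun z => (hasDerivAt_phiF_z hg t x y z).continuousAt

lemma continuous_pdh_pdz_ur (hg : Smooth3 g) (a b : ℕ) (x y : ℝ) :
    Continuous fun z => pdh a b (pdz (ur t g)) x y z := by
  simp only [pdh_pdz_ur hg]
  have h1 := (hg.pdz.pdh a b).continuous_z x y
  have h2 := (hg.pdh a b).continuous_z x y
  have h3 := continuous_phiF_z (t := t) (hg.pdh a b) x y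
  fun_prop

lemma continuous_pdh_uzv (hg : Smooth3 g) (a b : ℕ) (x y : ℝ) :
    Continuous fun z => pdh a b (uzv t g) x y z := by
  simp only [pdh_uzv hg]
  have h1 := continuous_phiF_z (t := t) (hg.pdh (a + 1) b) x y
  have h2 := continuous_phiF_z (t := t) (hg.pdh a (b + 1)) x y
  have h3 := continuous_phiF_z (t := t) (hg.pdh a b) x y
  fun_prop

lemma lintegral_pdh_pdz_ur_le (hg : Smooth3 g) (hσ : 0 < σ) (hw : angT t = σ ^ 4) (a b : ℕ)
    (x y : ℝ) :
    ∫⁻ s in Ioi (0 : ℝ), ENNReal.ofReal (thw t (1 / 2) s) * ‖pdh a b (pdz (ur t g)) x y s‖ₑ ≤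
      300 * vertF t σ g a b x y := by
  have hP := (hg.pdz.pdh a b).continuous_z x y
  have hG := (hg.pdh a b).continuous_z x y
  have hth := continuous_thw t (3 / 4)
  calc ∫⁻ s in Ioi (0 : ℝ), ENNReal.ofReal (thw t (1 / 2) s) * ‖pdh a b (pdz (ur t g)) x y s‖ₑ
      ≤ ∫⁻ s in Ioi (0 : ℝ), (ENNReal.ofReal (thw t (3 / 4) s) * ‖pdh a b (pdz g) x y s‖ₑ +
          (ENNReal.ofReal (2 / σ ^ 2) *
            (ENNReal.ofReal (thw t (3 / 4) s) * ‖pdh a b g x y s‖ₑ) +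
          ENNReal.ofReal (18 / σ ^ 3) * vert t (pdh a b g) x y *
            ENNReal.ofReal (thw t (-(1 / 4)) s))) := by
        refine setLIntegral_mono' measurableSet_Ioi fun s (hs : 0 < s) => ?_
        rw [pdh_pdz_ur hg]
        have hφ := enorm_phiF_le (hg.pdh a b) hσ hw x y hs
        have e1 : thw t (1 / 2) s ≤ thw t (3 / 4) s := thw_mono_left hw (by norm_num) s
        have h1 := self_le_mul_thw hσ hw s
        have h2 := sq_le_mul_thw hσ hw (l := 1 / 4) (by norm_num) s
        have h3 := one_le_thw hw (l := 1 / 4) (by norm_num) s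
        have p1 := thw_pos t (1 / 2) s
        have p2 := thw_pos t (1 / 4) s
        have e2 : thw t (1 / 2) s * |s / (2 * angT t)| ≤ 2 / σ ^ 2 * thw t (3 / 4) s := by
          rw [abs_of_pos (by rw [hw]; positivity), hw,
            show (3 / 4 : ℝ) = 1 / 2 + 1 / 4 by norm_num, thw_add]
          calc thw t (1 / 2) s * (s / (2 * σ ^ 4)) ≤
              thw t (1 / 2) s * (4 * σ ^ 2 * thw t (1 / 4) s / (2 * σ ^ 4)) := by gcongr
            _ = _ := by field_simp; ring
        have e3 : thw t (1 / 2) s * |(s / (2 * angT t)) ^ 2 - 1 / (2 * angT t)| *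
            (2 * σ * thw t (-1) s) ≤ 18 / σ ^ 3 * thw t (-(1 / 4)) s := by
          have : |(s / (2 * angT t)) ^ 2 - 1 / (2 * angT t)| ≤ 9 / σ ^ 4 * thw t (1 / 4) s := by
            rw [hw]
            refine (abs_sub _ _).trans ?_
            rw [abs_of_nonneg (by positivity), abs_of_nonneg (by positivity)]
            calc (s / (2 * σ ^ 4)) ^ 2 + 1 / (2 * σ ^ 4) = (s ^ 2 / σ ^ 4 + 2) / (4 * σ ^ 4) := by
                  field_simp
                  ring
              _ ≤ ((8 / (1 / 4) * σ ^ 4 * thw t (1 / 4) s) / σ ^ 4 + 2 * thw t (1 / 4) s) /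
                  (4 * σ ^ 4) := by gcongr; linarith
              _ ≤ 9 / σ ^ 4 * thw t (1 / 4) s := by
                  field_simp
                  norm_num
          calc _ ≤ thw t (1 / 2) s * (9 / σ ^ 4 * thw t (1 / 4) s) * (2 * σ * thw t (-1) s) := by
                have := thw_pos t (-1) s
                gcongr
            _ = 18 / σ ^ 3 * (thw t (1 / 2) s * thw t (1 / 4) s * thw t (-1) s) := by
                field_simp
                ring
            _ = _ := by rw [← thw_add, ← thw_add]; norm_num
        calc _ ≤ ENNReal.ofReal (thw t (1 / 2) s) * (‖pdh a b (pdz g) x y s‖ₑ +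
              ‖s / (2 * angT t) * pdh a b g x y s‖ₑ +
              ‖((s / (2 * angT t)) ^ 2 - 1 / (2 * angT t)) * phiF t (pdh a b g) x y s‖ₑ) := by
              gcongr
              exact (enorm_add_le _ _).trans (add_le_add_left enorm_sub_le _)
          _ ≤ ENNReal.ofReal (thw t (1 / 2) s) * (‖pdh a b (pdz g) x y s‖ₑ +
              ENNReal.ofReal |s / (2 * angT t)| * ‖pdh a b g x y s‖ₑ +
              ENNReal.ofReal |(s / (2 * angT t)) ^ 2 - 1 / (2 * angT t)| *
                (ENNReal.ofReal (2 * σ * thw t (-1) s) * vert t (pdh a b g) x y)) := by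
              rw [enorm_mul_eq, enorm_mul_eq]
              gcongr
          _ = ENNReal.ofReal (thw t (1 / 2) s) * ‖pdh a b (pdz g) x y s‖ₑ +
              (ENNReal.ofReal (thw t (1 / 2) s * |s / (2 * angT t)|) * ‖pdh a b g x y s‖ₑ +
              ENNReal.ofReal (thw t (1 / 2) s * |(s / (2 * angT t)) ^ 2 - 1 / (2 * angT t)| *
                (2 * σ * thw t (-1) s)) * vert t (pdh a b g) x y) := by
              rw [ENNReal.ofReal_mul (q := 2 * σ * thw t (-1) s) (by positivity),
                ENNReal.ofReal_mul (q := |s / (2 * angT t)|) p1.le,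
                ENNReal.ofReal_mul (q := |(s / (2 * angT t)) ^ 2 - 1 / (2 * angT t)|) p1.le]
              ring
          _ ≤ ENNReal.ofReal (thw t (3 / 4) s) * ‖pdh a b (pdz g) x y s‖ₑ +
              (ENNReal.ofReal (2 / σ ^ 2 * thw t (3 / 4) s) * ‖pdh a b g x y s‖ₑ +
              ENNReal.ofReal (18 / σ ^ 3 * thw t (-(1 / 4)) s) * vert t (pdh a b g) x y) := by
              gcongr
          _ = _ := by
              rw [ENNReal.ofReal_mul (by positivity), ENNReal.ofReal_mul (by positivity)]
              ring
    _ = (∫⁻ s in Ioi (0 : ℝ), ENNReal.ofReal (thw t (3 / 4) s) * ‖pdh a b (pdz g) x y s‖ₑ) +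
        (ENNReal.ofReal (2 / σ ^ 2) *
          (∫⁻ s in Ioi (0 : ℝ), ENNReal.ofReal (thw t (3 / 4) s) * ‖pdh a b g x y s‖ₑ) +
        ENNReal.ofReal (18 / σ ^ 3) * vert t (pdh a b g) x y *
          ∫⁻ s in Ioi (0 : ℝ), ENNReal.ofReal (thw t (-(1 / 4)) s)) := by
        have m1 : Measurable fun s => ENNReal.ofReal (thw t (3 / 4) s) * ‖pdh a b (pdz g) x y s‖ₑ :=
          hth.measurable.ennreal_ofReal.mul hP.measurable.enorm
        have m2 : Measurable fun s => ENNReal.ofReal (thw t (3 / 4) s) * ‖pdh a b g x y s‖ₑ :=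
          hth.measurable.ennreal_ofReal.mul hG.measurable.enorm
        rw [lintegral_add_left m1, lintegral_add_left (m2.const_mul _), lintegral_const_mul _ m2,
          lintegral_const_mul _ (continuous_thw t _).measurable.ennreal_ofReal]
    _ ≤ ENNReal.ofReal (4 * σ) * vert t (pdh a b (pdz g)) x y +
        (ENNReal.ofReal (2 / σ ^ 2) * (ENNReal.ofReal (4 * σ) * vert t (pdh a b g) x y) +
        ENNReal.ofReal (18 / σ ^ 3) * vert t (pdh a b g) x y * ENNReal.ofReal (11 * σ ^ 2)) := by
        gcongr
        · exact lintegral_thw_mul_le (hg.pdz.pdh a b) hσ hw x y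
        · exact lintegral_thw_mul_le (hg.pdh a b) hσ hw x y
        · exact lintegral_thw_neg_le hσ hw le_rfl
    _ = 4 * (ENNReal.ofReal σ * vert t (pdh a b (pdz g)) x y) +
        206 * (ENNReal.ofReal σ⁻¹ * vert t (pdh a b g) x y) := by
        have e1 : ENNReal.ofReal (4 * σ) = 4 * ENNReal.ofReal σ := by
          rw [ENNReal.ofReal_mul (by norm_num)]; norm_num
        have e2 : ENNReal.ofReal (2 / σ ^ 2) * ENNReal.ofReal (4 * σ) =
            8 * ENNReal.ofReal σ⁻¹ := by
          rw [← ENNReal.ofReal_mul (by positivity), show 2 / σ ^ 2 * (4 * σ) = 8 * σ⁻¹ by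
            field_simp; norm_num, ENNReal.ofReal_mul (by norm_num)]
          norm_num
        have e3 : ENNReal.ofReal (18 / σ ^ 3) * ENNReal.ofReal (11 * σ ^ 2) =
            198 * ENNReal.ofReal σ⁻¹ := by
          rw [← ENNReal.ofReal_mul (by positivity), show 18 / σ ^ 3 * (11 * σ ^ 2) = 198 * σ⁻¹ by
            field_simp; norm_num, ENNReal.ofReal_mul (by norm_num)]
          norm_num
        rw [← mul_assoc (ENNReal.ofReal (2 / σ ^ 2)), e2,
          mul_right_comm (ENNReal.ofReal (18 / σ ^ 3)), e3, e1]
        ring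
    _ ≤ _ := by
        rw [vertF, mul_add]
        gcongr <;> norm_num

open Finset in
/-- the discrete convolution appearing in the Leibniz rule for `∂^{(a, b)}_h` -/
def leib {R : Type*} [CommSemiring R] (a b : ℕ) (K : ℕ → ℕ → ℕ → ℕ → R) : R :=
  ∑ q ∈ antidiagonal b, ∑ p ∈ antidiagonal a,
    ((b.choose q.1 * a.choose p.1 : ℕ) : R) * K p.1 q.1 p.2 q.2

lemma leib_mono {a b : ℕ} {K L : ℕ → ℕ → ℕ → ℕ → ℝ≥0∞} (h : ∀ i j k l, K i j k l ≤ L i j k l) :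
    leib a b K ≤ leib a b L :=
  Finset.sum_le_sum fun _ _ => Finset.sum_le_sum fun _ _ => mul_le_mul_right (h _ _ _ _) _

lemma mul_leib {R : Type*} [CommSemiring R] (a b : ℕ) (c : R) (K : ℕ → ℕ → ℕ → ℕ → R) :
    c * leib a b K = leib a b fun i j k l => c * K i j k l := by
  simp only [leib, Finset.mul_sum]
  exact Finset.sum_congr rfl fun _ _ => Finset.sum_congr rfl fun _ _ => by ring

lemma lintegral_leib {α : Type*} [MeasurableSpace α] {μ : Measure α} (a b : ℕ)
    {K : ℕ → ℕ → ℕ → ℕ → α → ℝ≥0∞} (hK : ∀ i j k l, Measurable (K i j k l)) :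
    ∫⁻ s, leib a b (fun i j k l => K i j k l s) ∂μ =
      leib a b fun i j k l => ∫⁻ s, K i j k l s ∂μ := by
  simp only [leib]
  rw [lintegral_finsetSum _ fun q _ => Finset.measurable_fun_sum _ fun p _ => (hK _ _ _ _).const_mul _]
  refine Finset.sum_congr rfl fun q _ => ?_
  rw [lintegral_finsetSum _ fun p _ => (hK _ _ _ _).const_mul _]
  exact Finset.sum_congr rfl fun p _ => lintegral_const_mul _ (hK _ _ _ _)

lemma enorm_pdh_mul_le (hg : Smooth3 g) (a b : ℕ) (x y z : ℝ) :
    ‖pdh a b (fun x' y' z' => pdz (ur t g) x' y' z' * uzv t g x' y' z') x y z‖ₑ ≤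
      leib a b fun i j k l =>
        ‖pdh i j (pdz (ur t g)) x y z‖ₑ * ‖pdh k l (uzv t g) x y z‖ₑ := by
  rw [pdh_pdz_ur_mul_uzv hg]
  refine (enorm_sum_le _ _).trans (Finset.sum_le_sum fun q _ => ?_)
  rw [Finset.mul_sum]
  refine (enorm_sum_le _ _).trans (Finset.sum_le_sum fun p _ => ?_)
  rw [← mul_assoc, enorm_mul, ← Nat.cast_mul, enorm_mul (pdh _ _ _ _ _ _)]
  gcongr
  rw [Real.enorm_of_nonneg (by positivity), ENNReal.ofReal_natCast]

lemma enorm_integral_pdh_le (hg : Smooth3 g) (hσ : 0 < σ) (hw : angT t = σ ^ 4) (a b : ℕ)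
    (x y : ℝ) {z : ℝ} (hz : 0 < z) :
    ‖∫ s in Ioi z,
      pdh a b (fun x' y' z' => pdz (ur t g) x' y' z' * uzv t g x' y' z') x y s‖ₑ ≤
      ENNReal.ofReal (600 * σ * thw t (-(3 / 2)) z) *
        leib a b fun i j k l => vertF t σ g i j x y * vertU t g k l x y := by
  calc _ ≤ ∫⁻ s in Ioi z, leib a b fun i j k l =>
        ‖pdh i j (pdz (ur t g)) x y s‖ₑ * ‖pdh k l (uzv t g) x y s‖ₑ :=
      (enorm_integral_le_lintegral_enorm _).trans
        (lintegral_mono fun s => enorm_pdh_mul_le hg a b x y s)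
    _ = leib a b fun i j k l => ∫⁻ s in Ioi z,
        ‖pdh i j (pdz (ur t g)) x y s‖ₑ * ‖pdh k l (uzv t g) x y s‖ₑ :=
      lintegral_leib a b fun i j k l => (continuous_pdh_pdz_ur hg i j x y).measurable.enorm.mul
        (continuous_pdh_uzv hg k l x y).measurable.enorm
    _ ≤ leib a b fun i j k l => ENNReal.ofReal (600 * σ * thw t (-(3 / 2)) z) *
        (vertF t σ g i j x y * vertU t g k l x y) := by
      refine leib_mono fun i j k l => ?_
      calc _ ≤ ∫⁻ s in Ioi z, ENNReal.ofReal (2 * σ * thw t (-(3 / 2)) z) * vertU t g k l x y *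
            (ENNReal.ofReal (thw t (1 / 2) s) * ‖pdh i j (pdz (ur t g)) x y s‖ₑ) := by
            refine setLIntegral_mono' measurableSet_Ioi fun s (hs : z < s) => ?_
            calc _ ≤ ‖pdh i j (pdz (ur t g)) x y s‖ₑ *
                  (ENNReal.ofReal (2 * σ * thw t (-1) s) * vertU t g k l x y) := by
                  gcongr
                  exact enorm_pdh_uzv_le hg hσ hw k l x y (hz.trans hs)
              _ ≤ ‖pdh i j (pdz (ur t g)) x y s‖ₑ *
                  (ENNReal.ofReal (2 * σ * thw t (-(3 / 2)) z * thw t (1 / 2) s) *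
                    vertU t g k l x y) := by
                  refine mul_le_mul_right (mul_le_mul_left (ENNReal.ofReal_le_ofReal ?_) _) _
                  rw [show (-1 : ℝ) = -(3 / 2) + 1 / 2 by norm_num, thw_add, ← mul_assoc (2 * σ)]
                  have hle : thw t (-(3 / 2)) s ≤ thw t (-(3 / 2)) z := by
                    rw [thw, thw, hw]
                    refine Real.exp_le_exp.2 ?_
                    have : z ^ 2 ≤ s ^ 2 := by gcongr
                    gcongr ?_ / _
                    nlinarith
                  have := thw_pos t (1 / 2) s
                  gcongr
              _ = _ := by
                  have := thw_pos t (-(3 / 2)) z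
                  rw [ENNReal.ofReal_mul (by positivity : 0 ≤ 2 * σ * thw t (-(3 / 2)) z)]
                  ring
        _ = ENNReal.ofReal (2 * σ * thw t (-(3 / 2)) z) * vertU t g k l x y *
            ∫⁻ s in Ioi z,
              (ENNReal.ofReal (thw t (1 / 2) s) * ‖pdh i j (pdz (ur t g)) x y s‖ₑ) :=
            lintegral_const_mul _ ((continuous_thw t _).measurable.ennreal_ofReal.mul
              (continuous_pdh_pdz_ur hg i j x y).measurable.enorm)
        _ ≤ ENNReal.ofReal (2 * σ * thw t (-(3 / 2)) z) * vertU t g k l x y *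
            (300 * vertF t σ g i j x y) := by
            gcongr
            exact (lintegral_mono_set (Ioi_subset_Ioi hz.le)).trans
              (lintegral_pdh_pdz_ur_le hg hσ hw i j x y)
        _ = _ := by
            rw [show 600 * σ * thw t (-(3 / 2)) z = 300 * (2 * σ * thw t (-(3 / 2)) z) by ring,
              ENNReal.ofReal_mul (by norm_num : (0 : ℝ) ≤ 300)]
            norm_num
            ring
    _ = _ := (mul_leib _ _ _ _).symm

lemma lintegral_vertical_le (hg : Smooth3 g) (hσ : 0 < σ) (hw : angT t = σ ^ 4) (a b : ℕ)
    (x y : ℝ) :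
    ∫⁻ z in Ioi (0 : ℝ), ‖z * thw t 2 z * angR x y ^ (2 * (a + b)) *
      (∫ s in Ioi z,
        pdh a b (fun x' y' z' => pdz (ur t g) x' y' z' * uzv t g x' y' z') x y s) *
      pdh a b g x y z‖ₑ ≤
      ENNReal.ofReal (9600 * σ ^ 4) * (ENNReal.ofReal (angR x y) ^ (2 * (a + b)) *
        leib a b (fun i j k l => vertF t σ g i j x y * vertU t g k l x y) *
          vert t (pdh a b g) x y) := by
  set S := leib a b (fun i j k l => vertF t σ g i j x y * vertU t g k l x y) with hS
  set R := ENNReal.ofReal (angR x y) ^ (2 * (a + b)) with hR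
  calc _ ≤ ∫⁻ z in Ioi (0 : ℝ), ENNReal.ofReal (2400 * σ ^ 3) * (R * S) *
        (ENNReal.ofReal (thw t (3 / 4) z) * ‖pdh a b g x y z‖ₑ) := by
        refine setLIntegral_mono' measurableSet_Ioi fun z (hz : 0 < z) => ?_
        have p1 := thw_pos t 2 z
        have p2 := thw_pos t (-(3 / 2)) z
        have p3 := angR_pos x y
        rw [enorm_mul, enorm_mul, enorm_mul _ (angR x y ^ _),
          Real.enorm_of_nonneg (by positivity : 0 ≤ z * thw t 2 z),
          Real.enorm_of_nonneg (by positivity : 0 ≤ angR x y ^ (2 * (a + b))),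
          ENNReal.ofReal_pow p3.le, ← hR]
        calc _ ≤ ENNReal.ofReal (z * thw t 2 z) * R *
              (ENNReal.ofReal (600 * σ * thw t (-(3 / 2)) z) * S) * ‖pdh a b g x y z‖ₑ := by
              gcongr
              exact enorm_integral_pdh_le hg hσ hw a b x y hz
          _ = ENNReal.ofReal (z * thw t 2 z * (600 * σ * thw t (-(3 / 2)) z)) * (R * S) *
              ‖pdh a b g x y z‖ₑ := by
              rw [ENNReal.ofReal_mul (by positivity : 0 ≤ z * thw t 2 z)]
              ring
          _ ≤ ENNReal.ofReal (2400 * σ ^ 3 * thw t (3 / 4) z) * (R * S) *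
              ‖pdh a b g x y z‖ₑ := by
              refine mul_le_mul_left (mul_le_mul_left (ENNReal.ofReal_le_ofReal ?_) _) _
              calc z * thw t 2 z * (600 * σ * thw t (-(3 / 2)) z)
                  = 600 * σ * z * thw t (1 / 2) z := by
                    rw [show (1 / 2 : ℝ) = 2 + -(3 / 2) by norm_num, thw_add]
                    ring
                _ ≤ 600 * σ * (4 * σ ^ 2 * thw t (1 / 4) z) * thw t (1 / 2) z := by
                    have := thw_pos t (1 / 2) z
                    gcongr
                    exact self_le_mul_thw hσ hw z
                _ = _ := by
                    rw [show (3 / 4 : ℝ) = 1 / 4 + 1 / 2 by norm_num, thw_add]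
                    ring
          _ = _ := by
              rw [ENNReal.ofReal_mul (by positivity : 0 ≤ 2400 * σ ^ 3)]
              ring
    _ = ENNReal.ofReal (2400 * σ ^ 3) * (R * S) *
        ∫⁻ z in Ioi (0 : ℝ), (ENNReal.ofReal (thw t (3 / 4) z) * ‖pdh a b g x y z‖ₑ) :=
        lintegral_const_mul _ ((continuous_thw t _).measurable.ennreal_ofReal.mul
          ((hg.pdh a b).continuous_z x y).measurable.enorm)
    _ ≤ ENNReal.ofReal (2400 * σ ^ 3) * (R * S) *
        (ENNReal.ofReal (4 * σ) * vert t (pdh a b g) x y) := by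
        gcongr
        exact lintegral_thw_mul_le (hg.pdh a b) hσ hw x y
    _ = _ := by
        rw [show 9600 * σ ^ 4 = 2400 * σ ^ 3 * (4 * σ) by ring,
          ENNReal.ofReal_mul (by positivity : 0 ≤ 2400 * σ ^ 3)]
        ring

end vertical

section sobolev

lemma sq_enorm_le_lintegral {h h' : ℝ → ℝ} (hd : ∀ x, HasDerivAt h (h' x) x)
    (hc : Continuous h') {c x : ℝ} (hx : x ∈ Icc c (c + 1)) :
    ‖h x‖ₑ ^ 2 ≤ 2 * ∫⁻ s in Icc c (c + 1), (‖h s‖ₑ ^ 2 + ‖h' s‖ₑ ^ 2) := by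
  have hh : Continuous h := continuous_iff_continuousAt.2 fun x => (hd x).continuousAt
  set J := ∫⁻ s in Icc c (c + 1), (‖h s‖ₑ ^ 2 + ‖h' s‖ₑ ^ 2) with hJ
  have key : ∀ s ∈ Icc c (c + 1), ‖h x‖ₑ ^ 2 ≤ ‖h s‖ₑ ^ 2 + J := by
    intro s hs
    have hint : ∫ r in s..x, 2 * h r * h' r = h x ^ 2 - h s ^ 2 := by
      refine intervalIntegral.integral_eq_sub_of_hasDerivAt (f := fun r => h r ^ 2) (fun r _ => ?_)
        ((by fun_prop : Continuous fun r => 2 * h r * h' r).intervalIntegrable _ _)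
      simpa using (hd r).fun_pow 2
    have e : h x ^ 2 = h s ^ 2 + ∫ r in s..x, 2 * h r * h' r := by rw [hint]; ring
    rw [← enorm_pow, e]
    refine (enorm_add_le _ _).trans ?_
    rw [enorm_pow]
    gcongr
    rw [← enorm_norm, intervalIntegral.norm_integral_eq_norm_integral_uIoc, enorm_norm]
    refine (enorm_integral_le_lintegral_enorm _).trans ?_
    calc ∫⁻ r in uIoc s x, ‖2 * h r * h' r‖ₑ ≤ ∫⁻ r in Icc c (c + 1), ‖2 * h r * h' r‖ₑ :=
          lintegral_mono_set (uIoc_subset_uIcc.trans (uIcc_subset_Icc hs hx))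
      _ ≤ J := lintegral_mono fun r => ?_
    rw [← enorm_pow, ← enorm_pow, Real.enorm_of_nonneg (sq_nonneg _),
      Real.enorm_of_nonneg (sq_nonneg _), ← ENNReal.ofReal_add (sq_nonneg _) (sq_nonneg _),
      Real.enorm_eq_ofReal_abs]
    refine ENNReal.ofReal_le_ofReal (abs_le.2 ⟨?_, ?_⟩)
    · nlinarith [sq_nonneg (h r + h' r)]
    · nlinarith [sq_nonneg (h r - h' r)]
  calc ‖h x‖ₑ ^ 2 = ∫⁻ _ in Icc c (c + 1), ‖h x‖ₑ ^ 2 := by simp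
    _ ≤ ∫⁻ s in Icc c (c + 1), (‖h s‖ₑ ^ 2 + J) := setLIntegral_mono' measurableSet_Icc key
    _ = (∫⁻ s in Icc c (c + 1), ‖h s‖ₑ ^ 2) + J := by
        rw [lintegral_add_right _ measurable_const]
        simp
    _ ≤ J + J := by
        gcongr
        exact lintegral_mono fun s => le_self_add
    _ = 2 * J := (two_mul J).symm

lemma weighted_sq_enorm_le {h h' : ℝ → ℝ} (hd : ∀ x, HasDerivAt h (h' x) x)
    (hc : Continuous h') {W : ℝ → ℝ≥0∞} (hW : ∀ x s, |x| ≤ |s| → W x ≤ W s)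
    (x : ℝ) :
    W x * ‖h x‖ₑ ^ 2 ≤ 2 * ∫⁻ s, W s * (‖h s‖ₑ ^ 2 + ‖h' s‖ₑ ^ 2) := by
  have hh : Continuous h := continuous_iff_continuousAt.2 fun x => (hd x).continuousAt
  obtain ⟨c, hx, hcs⟩ : ∃ c, x ∈ Icc c (c + 1) ∧ ∀ s ∈ Icc c (c + 1), |x| ≤ |s| := by
    rcases le_total 0 x with h0 | h0
    · exact ⟨x, ⟨le_rfl, by linarith⟩, fun s hs => abs_le_abs_of_nonneg h0 hs.1⟩
    · refine ⟨x - 1, ⟨by linarith, by linarith⟩, fun s hs => abs_le_abs_of_nonpos h0 ?_⟩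
      linarith [hs.2]
  calc W x * ‖h x‖ₑ ^ 2
      ≤ W x * (2 * ∫⁻ s in Icc c (c + 1), (‖h s‖ₑ ^ 2 + ‖h' s‖ₑ ^ 2)) := by
        gcongr
        exact sq_enorm_le_lintegral hd hc hx
    _ = 2 * ∫⁻ s in Icc c (c + 1), W x * (‖h s‖ₑ ^ 2 + ‖h' s‖ₑ ^ 2) := by
        rw [lintegral_const_mul _ (by fun_prop)]
        ring
    _ ≤ 2 * ∫⁻ s in Icc c (c + 1), W s * (‖h s‖ₑ ^ 2 + ‖h' s‖ₑ ^ 2) := by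
        gcongr 2 * ?_
        refine setLIntegral_mono' measurableSet_Icc fun s hs => ?_
        gcongr
        exact hW x s (hcs s hs)
    _ ≤ _ := by
        gcongr 2 * ?_
        exact setLIntegral_le_lintegral _ _

end sobolev

section horizontal

variable {f : ℝ → ℝ → ℝ → ℝ} {t : ℝ}

lemma one_le_angR (x y : ℝ) : 1 ≤ angR x y :=
  Real.one_le_sqrt.2 (by nlinarith [sq_nonneg x, sq_nonneg y])

lemma angR_le_angR {x y x' y' : ℝ} (hx : |x| ≤ |x'|) (hy : |y| ≤ |y'|) :
    angR x y ≤ angR x' y' := by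
  have h1 := sq_le_sq.2 hx
  have h2 := sq_le_sq.2 hy
  unfold angR
  gcongr

lemma measurable_angR : Measurable fun p : ℝ × ℝ => ENNReal.ofReal (angR p.1 p.2) := by
  unfold angR
  fun_prop

lemma measurable_mul_add_four {α : Type*} [MeasurableSpace α] {w a b c d : α → ℝ≥0∞}
    (hw : Measurable w) (ha : Measurable a) (hb : Measurable b) (hc : Measurable c)
    (hd : Measurable d) : Measurable fun p => w p * (a p + b p + (c p + d p)) := by
  fun_prop

lemma lintegral_add_four {α : Type*} [MeasurableSpace α] {μ : Measure α} {a b c d : α → ℝ≥0∞}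
    (ha : Measurable a) (hb : Measurable b) (hc : Measurable c) :
    ∫⁻ p, (a p + b p + (c p + d p)) ∂μ =
      ∫⁻ p, a p ∂μ + ∫⁻ p, b p ∂μ + (∫⁻ p, c p ∂μ + ∫⁻ p, d p ∂μ) := by
  rw [← lintegral_add_left ha, ← lintegral_add_left hc]
  exact lintegral_add_left (ha.add hb) _

lemma mul_add_four (u w a b c d : ℝ≥0∞) :
    u * (w * (a + b + (c + d))) = w * (u * a + u * b + (u * c + u * d)) := by
  ring

lemma measurable_sq_slice (hf : Smooth3 f) (z : ℝ) :
    Measurable fun p : ℝ × ℝ => ‖f p.1 p.2 z‖ₑ ^ 2 :=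
  ((hf.continuous.comp
    (by fun_prop : Continuous fun p : ℝ × ℝ => (p.1, p.2, z))).measurable.enorm).pow_const 2

lemma Measurable.section_snd {α β γ : Type*} [MeasurableSpace α] [MeasurableSpace β]
    [MeasurableSpace γ] {F : α × β → γ} (hF : Measurable F) (x : α) :
    Measurable fun y => F (x, y) :=
  hF.comp measurable_prodMk_left

lemma Measurable.swap_args {α β γ : Type*} [MeasurableSpace α] [MeasurableSpace β]
    [MeasurableSpace γ] {F : α × β → γ} (hF : Measurable F) :
    Measurable fun q : β × α => F (q.2, q.1) :=
  hF.comp measurable_swap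

lemma horizontal_sobolev_snd (hf : Smooth3 f) (k : ℕ) (x y z : ℝ) :
    ENNReal.ofReal (angR x y) ^ k * ‖f x y z‖ₑ ^ 2 ≤ 2 * ∫⁻ s, ENNReal.ofReal (angR x s) ^ k *
      (‖f x s z‖ₑ ^ 2 + ‖pdy f x s z‖ₑ ^ 2) :=
  weighted_sq_enorm_le (h := fun y => f x y z) (h' := fun y => pdy f x y z)
    (W := fun y => ENNReal.ofReal (angR x y) ^ k) (fun y => hf.hasDerivAt_y x y z)
    (hf.pdy.continuous.comp (by fun_prop : Continuous fun y : ℝ => (x, y, z)))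
    (fun y s hys => by gcongr; exact angR_le_angR le_rfl hys) y

lemma horizontal_sobolev_fst (hf : Smooth3 f) (k : ℕ) (x y z : ℝ) :
    ENNReal.ofReal (angR x y) ^ k * ‖f x y z‖ₑ ^ 2 ≤ 2 * ∫⁻ s, ENNReal.ofReal (angR s y) ^ k *
      (‖f s y z‖ₑ ^ 2 + ‖pdx f s y z‖ₑ ^ 2) :=
  weighted_sq_enorm_le (h := fun x => f x y z) (h' := fun x => pdx f x y z)
    (W := fun x => ENNReal.ofReal (angR x y) ^ k) (fun x => hf.hasDerivAt_x x y z)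
    (hf.pdx.continuous.comp (by fun_prop : Continuous fun x : ℝ => (x, y, z)))
    (fun x s hxs => by gcongr; exact angR_le_angR hxs le_rfl) x

lemma horizontal_sobolev (hf : Smooth3 f) (k : ℕ) (x y z : ℝ) :
    ENNReal.ofReal (angR x y) ^ k * ‖f x y z‖ₑ ^ 2 ≤
      4 * ∫⁻ p : ℝ × ℝ, ENNReal.ofReal (angR p.1 p.2) ^ k *
        (‖f p.1 p.2 z‖ₑ ^ 2 + ‖pdy f p.1 p.2 z‖ₑ ^ 2 +
          (‖pdx f p.1 p.2 z‖ₑ ^ 2 + ‖pdx (pdy f) p.1 p.2 z‖ₑ ^ 2)) := by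
  have mm := measurable_mul_add_four (measurable_angR.pow_const k) (measurable_sq_slice hf z)
    (measurable_sq_slice hf.pdy z) (measurable_sq_slice hf.pdx z) (measurable_sq_slice hf.pdy.pdx z)
  refine (horizontal_sobolev_fst hf k x y z).trans ?_
  rw [Measure.volume_eq_prod, lintegral_prod _ mm.aemeasurable,
    show (4 : ℝ≥0∞) = 2 * 2 by norm_num, mul_assoc]
  refine mul_le_mul_right ?_ _
  rw [← lintegral_const_mul _ mm.lintegral_prod_right']
  refine lintegral_mono fun s => ?_
  have m1 : Measurable fun r => ENNReal.ofReal (angR s r) ^ k *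
      (‖f s r z‖ₑ ^ 2 + ‖pdy f s r z‖ₑ ^ 2) := by
    have h := ((measurable_angR.pow_const k).mul ((measurable_sq_slice hf z).add
      (measurable_sq_slice hf.pdy z))).section_snd s
    exact h
  have h1 := horizontal_sobolev_snd hf k s y z
  have h2 := horizontal_sobolev_snd hf.pdx k s y z
  rw [hf.pdy_pdx] at h2
  simp only [mul_add _ (‖f _ _ _‖ₑ ^ 2 + _)]
  rw [lintegral_add_left m1, mul_add, mul_add]
  exact add_le_add h1 h2

/-- the `L²_h` norm of `⟨r⟩^k F` -/
def normH (k : ℕ) (F : ℝ → ℝ → ℝ≥0∞) : ℝ≥0∞ :=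
  l2 (volume : Measure (ℝ × ℝ)) fun p => ENNReal.ofReal (angR p.1 p.2) ^ k * F p.1 p.2

lemma normH_mono_left {k l : ℕ} (h : k ≤ l) (F : ℝ → ℝ → ℝ≥0∞) : normH k F ≤ normH l F := by
  refine l2_mono fun p => mul_le_mul_left (pow_le_pow_right₀ ?_ h) _
  exact ENNReal.one_le_ofReal.2 (one_le_angR _ _)

lemma measurable_sq_thw (hf : Smooth3 f) :
    Measurable fun q : (ℝ × ℝ) × ℝ => ‖thw t 1 q.2 * f q.1.1 q.1.2 q.2‖ₑ ^ 2 := by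
  have h := hf.continuous.comp
    (by fun_prop : Continuous fun q : (ℝ × ℝ) × ℝ => (q.1.1, q.1.2, q.2))
  exact ((((continuous_thw t 1).comp continuous_snd).mul h).measurable.enorm).pow_const 2

lemma measurable_vert (hf : Smooth3 f) : Measurable fun p : ℝ × ℝ => vert t f p.1 p.2 := by
  unfold vert l2
  simp only [ENNReal.rpow_two]
  exact (measurable_sq_thw hf).lintegral_prod_right'.pow_const _

lemma vert_sq (x y : ℝ) :
    vert t f x y ^ 2 = ∫⁻ z in Ioi (0 : ℝ), ‖thw t 1 z * f x y z‖ₑ ^ 2 := l2_sq _ _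

lemma angR_mul_vert_le (hf : Smooth3 f) (k : ℕ) (x y : ℝ) :
    ENNReal.ofReal (angR x y) ^ k * vert t f x y ≤
      2 * (normH k (vert t f) + normH k (vert t (pdy f)) + (normH k (vert t (pdx f)) +
        normH k (vert t (pdx (pdy f))))) := by
  refine (ENNReal.pow_le_pow_left_iff two_ne_zero).1 ?_
  have mW := measurable_angR.pow_const (k * 2)
  have hN : ∀ {u : ℝ → ℝ → ℝ → ℝ}, Smooth3 u → ∫⁻ p : ℝ × ℝ, ENNReal.ofReal (angR p.1 p.2) ^ (k * 2) *
      vert t u p.1 p.2 ^ 2 = normH k (vert t u) ^ 2 := fun hu => by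
    rw [normH, l2_sq]
    simp only [mul_pow, pow_mul]
  have hmul : ∀ (u : ℝ → ℝ → ℝ → ℝ) (x y z : ℝ), ‖thw t 1 z * u x y z‖ₑ ^ 2 =
      ‖thw t 1 z‖ₑ ^ 2 * ‖u x y z‖ₑ ^ 2 := fun u x y z => by rw [enorm_mul, mul_pow]
  calc (ENNReal.ofReal (angR x y) ^ k * vert t f x y) ^ 2
      = ∫⁻ z in Ioi (0 : ℝ), ENNReal.ofReal (angR x y) ^ (k * 2) * ‖thw t 1 z * f x y z‖ₑ ^ 2 := by
        rw [mul_pow, vert_sq, ← pow_mul, lintegral_const_mul]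
        have h := (measurable_sq_thw (t := t) hf).section_snd (x, y)
        exact h
    _ ≤ ∫⁻ z in Ioi (0 : ℝ), 4 * ∫⁻ p : ℝ × ℝ, ENNReal.ofReal (angR p.1 p.2) ^ (k * 2) *
        (‖thw t 1 z * f p.1 p.2 z‖ₑ ^ 2 + ‖thw t 1 z * pdy f p.1 p.2 z‖ₑ ^ 2 +
          (‖thw t 1 z * pdx f p.1 p.2 z‖ₑ ^ 2 + ‖thw t 1 z * pdx (pdy f) p.1 p.2 z‖ₑ ^ 2)) := by
        refine lintegral_mono fun z => ?_
        simp only [hmul]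
        rw [mul_left_comm]
        refine (mul_le_mul_right (horizontal_sobolev hf _ x y z) _).trans_eq ?_
        rw [mul_left_comm, ← lintegral_const_mul' _ _ (by finiteness)]
        simp only [mul_add_four]
    _ = 4 * ∫⁻ p : ℝ × ℝ, ∫⁻ z in Ioi (0 : ℝ), ENNReal.ofReal (angR p.1 p.2) ^ (k * 2) *
        (‖thw t 1 z * f p.1 p.2 z‖ₑ ^ 2 + ‖thw t 1 z * pdy f p.1 p.2 z‖ₑ ^ 2 +
          (‖thw t 1 z * pdx f p.1 p.2 z‖ₑ ^ 2 + ‖thw t 1 z * pdx (pdy f) p.1 p.2 z‖ₑ ^ 2)) := by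
        rw [lintegral_const_mul' _ _ (by finiteness), lintegral_lintegral_swap]
        have := (measurable_mul_add_four (mW.comp measurable_fst) (measurable_sq_thw (t := t) hf)
          (measurable_sq_thw (t := t) hf.pdy) (measurable_sq_thw (t := t) hf.pdx)
          (measurable_sq_thw (t := t) hf.pdy.pdx)).swap_args
        exact this.aemeasurable
    _ = 4 * ∫⁻ p : ℝ × ℝ, (ENNReal.ofReal (angR p.1 p.2) ^ (k * 2) * vert t f p.1 p.2 ^ 2 +
        ENNReal.ofReal (angR p.1 p.2) ^ (k * 2) * vert t (pdy f) p.1 p.2 ^ 2 +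
          (ENNReal.ofReal (angR p.1 p.2) ^ (k * 2) * vert t (pdx f) p.1 p.2 ^ 2 +
          ENNReal.ofReal (angR p.1 p.2) ^ (k * 2) * vert t (pdx (pdy f)) p.1 p.2 ^ 2)) := by
        congr 1
        refine lintegral_congr fun p => ?_
        have m : ∀ {u : ℝ → ℝ → ℝ → ℝ}, Smooth3 u →
            Measurable fun z => ‖thw t 1 z * u p.1 p.2 z‖ₑ ^ 2 := fun hu => by
          have h := (measurable_sq_thw (t := t) hu).section_snd p
          exact h
        rw [lintegral_const_mul' _ _ (by finiteness),
          lintegral_add_four (m hf) (m hf.pdy) (m hf.pdx)]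
        simp only [vert_sq]
        ring
    _ = 4 * (normH k (vert t f) ^ 2 + normH k (vert t (pdy f)) ^ 2 +
        (normH k (vert t (pdx f)) ^ 2 + normH k (vert t (pdx (pdy f))) ^ 2)) := by
        have m : ∀ {u : ℝ → ℝ → ℝ → ℝ}, Smooth3 u → Measurable fun p : ℝ × ℝ =>
            ENNReal.ofReal (angR p.1 p.2) ^ (k * 2) * vert t u p.1 p.2 ^ 2 := fun hu =>
          mW.mul ((measurable_vert hu).pow_const 2)
        rw [lintegral_add_four (m hf) (m hf.pdy) (m hf.pdx), hN hf, hN hf.pdy, hN hf.pdx, hN hf.pdy.pdx]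
    _ ≤ _ := by
        rw [mul_pow]
        norm_num
        gcongr 4 * ?_
        have hs : ∀ a b : ℝ≥0∞, a ^ 2 + b ^ 2 ≤ (a + b) ^ 2 := fun a b =>
          calc a ^ 2 + b ^ 2 ≤ a ^ 2 + b ^ 2 + 2 * a * b := le_self_add
            _ = _ := by ring
        exact (add_le_add (hs _ _) (hs _ _)).trans (hs _ _)

/-- square integrability of `θ ⟨r⟩ⁿ f` over the half space -/
lemma normH_vert (hf : Smooth3 f) (n : ℕ)
    (hi : Integrable (fun p : ℝ × ℝ × ℝ => (thw t 1 p.2.2 * angR p.1 p.2.1 ^ n * f p.1 p.2.1 p.2.2) ^ 2)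
      (volume.restrict {p : ℝ × ℝ × ℝ | 0 < p.2.2})) :
    normH n (vert t f) = ENNReal.ofReal (L2w t 1 n f) := by
  have hset : {p : ℝ × ℝ × ℝ | 0 < p.2.2} = univ ×ˢ (univ ×ˢ Ioi (0 : ℝ)) := by
    ext p; simp
  rw [hset, Measure.volume_eq_prod, ← Measure.prod_restrict, Measure.volume_eq_prod,
    ← Measure.prod_restrict, Measure.restrict_univ] at hi
  have e1 : ∫ x : ℝ, ∫ y : ℝ, ∫ z in Ioi (0 : ℝ), (thw t 1 z * angR x y ^ n * f x y z) ^ 2 =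
      ∫ p, (thw t 1 p.2.2 * angR p.1 p.2.1 ^ n * f p.1 p.2.1 p.2.2) ^ 2
        ∂((volume : Measure ℝ).prod ((volume : Measure ℝ).prod (volume.restrict (Ioi (0 : ℝ))))) := by
    rw [integral_prod _ hi]
    refine integral_congr_ae ?_
    filter_upwards [hi.prod_right_ae] with x hx
    rw [integral_prod _ hx]
  refine (ENNReal.pow_right_strictMono two_ne_zero).injective ?_
  have hnn : 0 ≤ ∫ x : ℝ, ∫ y : ℝ, ∫ z in Ioi (0 : ℝ), (thw t 1 z * angR x y ^ n * f x y z) ^ 2 := by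
    rw [e1]
    exact integral_nonneg fun p => sq_nonneg _
  have hmeas : Measurable fun p : ℝ × ℝ × ℝ => ENNReal.ofReal
      ((thw t 1 p.2.2 * angR p.1 p.2.1 ^ n * f p.1 p.2.1 p.2.2) ^ 2) := by
    have := hf.continuous
    have h1 : Continuous fun p : ℝ × ℝ × ℝ => thw t 1 p.2.2 := (continuous_thw t 1).comp (by fun_prop)
    have h2 : Continuous fun p : ℝ × ℝ × ℝ => angR p.1 p.2.1 := by unfold angR; fun_prop
    have h3 : Continuous fun p : ℝ × ℝ × ℝ =>
        (thw t 1 p.2.2 * angR p.1 p.2.1 ^ n * f p.1 p.2.1 p.2.2) ^ 2 := by fun_prop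
    exact h3.measurable.ennreal_ofReal
  rw [L2w, ← ENNReal.ofReal_pow (Real.sqrt_nonneg _), Real.sq_sqrt hnn, e1,
    ofReal_integral_eq_lintegral_ofReal hi (Eventually.of_forall fun p => sq_nonneg _),
    lintegral_prod _ hmeas.aemeasurable, normH, l2_sq, Measure.volume_eq_prod, lintegral_prod]
  · refine lintegral_congr fun x => ?_
    have hx : Measurable fun q : ℝ × ℝ => ENNReal.ofReal
        ((thw t 1 q.2 * angR x q.1 ^ n * f x q.1 q.2) ^ 2) := by
      have h := hmeas.section_snd x
      exact h
    rw [lintegral_prod _ hx.aemeasurable]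
    refine lintegral_congr fun y => ?_
    rw [mul_pow, vert_sq, ← lintegral_const_mul' _ _ (by finiteness)]
    refine lintegral_congr fun z => ?_
    rw [← ENNReal.ofReal_pow (angR_pos x y).le, ← ENNReal.ofReal_pow (by have := angR_pos x y; positivity),
      ← enorm_pow, Real.enorm_of_nonneg (sq_nonneg _), ← ENNReal.ofReal_mul (by positivity)]
    congr 1
    ring
  · exact (((measurable_angR.pow_const n).mul (measurable_vert hf)).pow_const 2).aemeasurable

end horizontal

section core

variable {f g : ℝ → ℝ → ℝ → ℝ} {t σ : ℝ}

/-- the weighted norm `‖θ ⟨r⟩^{|α|} ∂^α_h f‖_{L²}` with `α = (a, b)` -/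
def nrmA (t : ℝ) (f : ℝ → ℝ → ℝ → ℝ) (a b : ℕ) : ℝ := L2w t 1 (a + b) (pdh a b f)

/-- the sum of a doubly indexed family over the unit square with lower corner `(a, b)` -/
def squareSum (p : ℕ → ℕ → ℝ) (a b : ℕ) : ℝ :=
  p a b + p a (b + 1) + (p (a + 1) b + p (a + 1) (b + 1))

/-- the combination of norms controlling `∂^{(a, b)}_h u^z` -/
def velSum (p : ℕ → ℕ → ℝ) (a b : ℕ) : ℝ :=
  p (a + 1) b + p a (b + 1) + (a + b + 2) * p a b

/-- the combination of norms controlling `∂^{(a, b)}_h ∂_z u^r` -/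
def shearSum (t σ : ℝ) (g : ℝ → ℝ → ℝ → ℝ) (a b : ℕ) : ℝ :=
  σ * nrmA t (pdz g) a b + σ⁻¹ * nrmA t g a b

lemma nrmA_nonneg (a b : ℕ) : 0 ≤ nrmA t f a b := Real.sqrt_nonneg _

lemma squareSum_nonneg {p : ℕ → ℕ → ℝ} (hp : ∀ a b, 0 ≤ p a b) (a b : ℕ) : 0 ≤ squareSum p a b :=
  add_nonneg (add_nonneg (hp _ _) (hp _ _)) (add_nonneg (hp _ _) (hp _ _))

lemma velSum_nonneg {p : ℕ → ℕ → ℝ} (hp : ∀ a b, 0 ≤ p a b) (a b : ℕ) : 0 ≤ velSum p a b :=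
  add_nonneg (add_nonneg (hp _ _) (hp _ _)) (mul_nonneg (by positivity) (hp _ _))

lemma shearSum_nonneg (hσ : 0 < σ) (a b : ℕ) : 0 ≤ shearSum t σ g a b :=
  add_nonneg (mul_nonneg hσ.le (nrmA_nonneg _ _))
    (mul_nonneg (inv_nonneg.2 hσ.le) (nrmA_nonneg _ _))

lemma normH_vert_pdh (hf : Smooth3 f) (hc : L2cond t f) {n a b : ℕ} (hn : n = a + b) :
    normH n (vert t (pdh a b f)) = ENNReal.ofReal (nrmA t f a b) := by
  subst hn
  exact normH_vert (hf.pdh a b) (a + b) (hc a b)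

lemma normH_vert_pdh_le (hf : Smooth3 f) (hc : L2cond t f) {n a b : ℕ} (hn : n ≤ a + b) :
    normH n (vert t (pdh a b f)) ≤ ENNReal.ofReal (nrmA t f a b) :=
  (normH_mono_left hn _).trans_eq (normH_vert_pdh hf hc rfl)

lemma angR_mul_vert_pdh_le (hf : Smooth3 f) (hc : L2cond t f) {n a b : ℕ} (hn : n = a + b)
    (x y : ℝ) :
    ENNReal.ofReal (angR x y) ^ n * vert t (pdh a b f) x y ≤
      2 * ENNReal.ofReal (squareSum (nrmA t f) a b) := by
  refine (angR_mul_vert_le (hf.pdh a b) n x y).trans ?_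
  have h0 : ∀ a b, 0 ≤ nrmA t f a b := nrmA_nonneg
  rw [hf.pdy_pdh, Smooth3.pdx_pdh, Smooth3.pdx_pdh, squareSum,
    ENNReal.ofReal_add (add_nonneg (h0 _ _) (h0 _ _)) (add_nonneg (h0 _ _) (h0 _ _)),
    ENNReal.ofReal_add (h0 _ _) (h0 _ _), ENNReal.ofReal_add (h0 _ _) (h0 _ _)]
  gcongr <;> exact normH_vert_pdh_le hf hc (by omega)

lemma measurable_vertF (hg : Smooth3 g) (a b : ℕ) :
    Measurable fun p : ℝ × ℝ => vertF t σ g a b p.1 p.2 :=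
  ((measurable_vert (hg.pdz.pdh a b)).const_mul _).add ((measurable_vert (hg.pdh a b)).const_mul _)

lemma measurable_vertU (hg : Smooth3 g) (a b : ℕ) :
    Measurable fun p : ℝ × ℝ => vertU t g a b p.1 p.2 :=
  ((measurable_angR.mul (measurable_vert (hg.pdh (a + 1) b))).add
    (measurable_angR.mul (measurable_vert (hg.pdh a (b + 1))))).add
      ((measurable_vert (hg.pdh a b)).const_mul _)

lemma normH_add_le {k : ℕ} {F G : ℝ → ℝ → ℝ≥0∞} (hF : Measurable fun p : ℝ × ℝ => F p.1 p.2)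
    (hG : Measurable fun p : ℝ × ℝ => G p.1 p.2) :
    normH k (fun x y => F x y + G x y) ≤ normH k F + normH k G := by
  have hW := measurable_angR.pow_const k
  simp only [normH, mul_add]
  exact l2_add_le (hW.mul hF).aemeasurable (hW.mul hG).aemeasurable

lemma normH_const_mul_le {k : ℕ} (c : ℝ≥0∞) {F : ℝ → ℝ → ℝ≥0∞}
    (hF : Measurable fun p : ℝ × ℝ => F p.1 p.2) :
    normH k (fun x y => c * F x y) ≤ c * normH k F := by
  have hW := measurable_angR.pow_const k
  simp only [normH, mul_left_comm _ c]
  exact l2_const_mul_le _ (hW.mul hF).aemeasurable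

lemma normH_angR_mul (k : ℕ) (F : ℝ → ℝ → ℝ≥0∞) :
    normH k (fun x y => ENNReal.ofReal (angR x y) * F x y) = normH (k + 1) F := by
  simp only [normH, pow_succ, mul_assoc]

lemma normH_vertF_le (hg : Smooth3 g) (hσ : 0 < σ) (hc : L2cond t g) (hz : L2condZ t g)
    (a b : ℕ) : normH (a + b) (vertF t σ g a b) ≤ ENNReal.ofReal (shearSum t σ g a b) := by
  have m1 := measurable_vert (t := t) (hg.pdz.pdh a b)
  have m2 := measurable_vert (t := t) (hg.pdh a b)
  rw [shearSum, ENNReal.ofReal_add (mul_nonneg hσ.le (nrmA_nonneg _ _))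
    (mul_nonneg (inv_nonneg.2 hσ.le) (nrmA_nonneg _ _)), ENNReal.ofReal_mul hσ.le,
    ENNReal.ofReal_mul (inv_nonneg.2 hσ.le), ← normH_vert_pdh hg hc rfl,
    ← normH_vert_pdh hg.pdz hz rfl]
  exact (normH_add_le (m1.const_mul _) (m2.const_mul _)).trans
    (add_le_add (normH_const_mul_le _ m1) (normH_const_mul_le _ m2))

lemma ofReal_velSum {p : ℕ → ℕ → ℝ} (hp : ∀ a b, 0 ≤ p a b) (a b : ℕ) :
    ENNReal.ofReal (velSum p a b) = ENNReal.ofReal (p (a + 1) b) + ENNReal.ofReal (p a (b + 1)) +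
      ENNReal.ofReal (a + b + 2) * ENNReal.ofReal (p a b) := by
  rw [velSum, ENNReal.ofReal_add (add_nonneg (hp _ _) (hp _ _)) (mul_nonneg (by positivity) (hp _ _)),
    ENNReal.ofReal_add (hp _ _) (hp _ _), ENNReal.ofReal_mul (by positivity)]

lemma normH_vertU_le (hg : Smooth3 g) (hc : L2cond t g) (a b : ℕ) :
    normH (a + b) (vertU t g a b) ≤ ENNReal.ofReal (velSum (nrmA t g) a b) := by
  have m1 := measurable_vert (t := t) (hg.pdh (a + 1) b)
  have m2 := measurable_vert (t := t) (hg.pdh a (b + 1))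
  have m3 := measurable_vert (t := t) (hg.pdh a b)
  rw [ofReal_velSum nrmA_nonneg, ← normH_vert_pdh hg hc (n := a + b + 1) (by omega),
    ← normH_vert_pdh hg hc (n := a + b + 1) (by omega), ← normH_vert_pdh hg hc rfl,
    ← normH_angR_mul, ← normH_angR_mul]
  refine (normH_add_le ((measurable_angR.mul m1).add (measurable_angR.mul m2))
    (m3.const_mul _)).trans (add_le_add ?_ (normH_const_mul_le _ m3))
  exact normH_add_le (measurable_angR.mul m1) (measurable_angR.mul m2)

lemma angR_mul_vertF_le (hg : Smooth3 g) (hσ : 0 < σ) (hc : L2cond t g) (hz : L2condZ t g)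
    (a b : ℕ) (x y : ℝ) :
    ENNReal.ofReal (angR x y) ^ (a + b) * vertF t σ g a b x y ≤
      2 * ENNReal.ofReal (squareSum (shearSum t σ g) a b) := by
  have e : squareSum (shearSum t σ g) a b = σ * squareSum (nrmA t (pdz g)) a b +
      σ⁻¹ * squareSum (nrmA t g) a b := by
    simp only [squareSum, shearSum]
    ring
  have h1 := squareSum_nonneg (nrmA_nonneg (f := pdz g) (t := t)) a b
  have h2 := squareSum_nonneg (nrmA_nonneg (f := g) (t := t)) a b
  rw [e, ENNReal.ofReal_add (by positivity) (by positivity), ENNReal.ofReal_mul hσ.le,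
    ENNReal.ofReal_mul (inv_nonneg.2 hσ.le), vertF]
  calc _ = ENNReal.ofReal σ * (ENNReal.ofReal (angR x y) ^ (a + b) * vert t (pdh a b (pdz g)) x y) +
        ENNReal.ofReal σ⁻¹ * (ENNReal.ofReal (angR x y) ^ (a + b) * vert t (pdh a b g) x y) := by
        ring
    _ ≤ ENNReal.ofReal σ * (2 * ENNReal.ofReal (squareSum (nrmA t (pdz g)) a b)) +
        ENNReal.ofReal σ⁻¹ * (2 * ENNReal.ofReal (squareSum (nrmA t g) a b)) :=
        add_le_add (mul_le_mul_right (angR_mul_vert_pdh_le hg.pdz hz rfl x y) _)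
          (mul_le_mul_right (angR_mul_vert_pdh_le hg hc rfl x y) _)
    _ = _ := by ring

lemma angR_mul_vertU_le (hg : Smooth3 g) (hc : L2cond t g) (a b : ℕ) (x y : ℝ) :
    ENNReal.ofReal (angR x y) ^ (a + b) * vertU t g a b x y ≤
      2 * ENNReal.ofReal (velSum (squareSum (nrmA t g)) a b) := by
  rw [ofReal_velSum (squareSum_nonneg nrmA_nonneg), vertU]
  calc _ = ENNReal.ofReal (angR x y) ^ (a + b + 1) * vert t (pdh (a + 1) b g) x y +
        ENNReal.ofReal (angR x y) ^ (a + b + 1) * vert t (pdh a (b + 1) g) x y +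
        ENNReal.ofReal (a + b + 2) *
          (ENNReal.ofReal (angR x y) ^ (a + b) * vert t (pdh a b g) x y) := by ring
    _ ≤ 2 * ENNReal.ofReal (squareSum (nrmA t g) (a + 1) b) +
        2 * ENNReal.ofReal (squareSum (nrmA t g) a (b + 1)) +
        ENNReal.ofReal (a + b + 2) * (2 * ENNReal.ofReal (squareSum (nrmA t g) a b)) :=
        add_le_add (add_le_add (angR_mul_vert_pdh_le hg hc (by omega) x y)
          (angR_mul_vert_pdh_le hg hc (by omega) x y))
          (mul_le_mul_right (angR_mul_vert_pdh_le hg hc rfl x y) _)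
    _ = _ := by ring

/-- an `L^∞`-`L²`-`L²` Hölder inequality with weights -/
lemma lintegral_trilinear_le {j m : ℕ} {F U G : ℝ → ℝ → ℝ≥0∞} {s : ℝ≥0∞}
    (hU : Measurable fun p : ℝ × ℝ => U p.1 p.2) (hG : Measurable fun p : ℝ × ℝ => G p.1 p.2)
    (hs : ∀ x y, ENNReal.ofReal (angR x y) ^ j * F x y ≤ s) :
    ∫⁻ p : ℝ × ℝ, ENNReal.ofReal (angR p.1 p.2) ^ (2 * (j + m)) * (F p.1 p.2 * U p.1 p.2) * G p.1 p.2 ≤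
      s * (normH m U * normH (j + m) G) := by
  have m1 := (measurable_angR.pow_const m).mul hU
  have m2 := (measurable_angR.pow_const (j + m)).mul hG
  calc _ ≤ ∫⁻ p : ℝ × ℝ, s * ((ENNReal.ofReal (angR p.1 p.2) ^ m * U p.1 p.2) *
        (ENNReal.ofReal (angR p.1 p.2) ^ (j + m) * G p.1 p.2)) := by
        refine lintegral_mono fun p => ?_
        refine le_trans (le_of_eq ?_) (mul_le_mul_left (hs p.1 p.2) _)
        ring
    _ = s * ∫⁻ p : ℝ × ℝ, (ENNReal.ofReal (angR p.1 p.2) ^ m * U p.1 p.2) *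
        (ENNReal.ofReal (angR p.1 p.2) ^ (j + m) * G p.1 p.2) :=
        lintegral_const_mul _ (m1.mul m2)
    _ ≤ _ := by
        gcongr
        exact lintegral_mul_le_l2 m1.aemeasurable m2.aemeasurable

/-- the coefficient bounding the `(i, j), (k, l)` term of the Leibniz expansion -/
def coeffK (t σ : ℝ) (g : ℝ → ℝ → ℝ → ℝ) (i j k l : ℕ) : ℝ :=
  if i + j ≤ k + l then squareSum (shearSum t σ g) i j * velSum (nrmA t g) k l
  else shearSum t σ g i j * velSum (squareSum (nrmA t g)) k l

lemma coeffK_nonneg (hσ : 0 < σ) (i j k l : ℕ) : 0 ≤ coeffK t σ g i j k l := by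
  unfold coeffK
  split_ifs
  · exact mul_nonneg (squareSum_nonneg (shearSum_nonneg hσ) _ _) (velSum_nonneg nrmA_nonneg _ _)
  · exact mul_nonneg (shearSum_nonneg hσ _ _)
      (velSum_nonneg (squareSum_nonneg nrmA_nonneg) _ _)

lemma lintegral_coeffK_le (hg : Smooth3 g) (hσ : 0 < σ) (hc : L2cond t g) (hz : L2condZ t g)
    {a b i j k l : ℕ} (ha : i + k = a) (hb : j + l = b) :
    ∫⁻ p : ℝ × ℝ, ENNReal.ofReal (angR p.1 p.2) ^ (2 * (a + b)) *
      (vertF t σ g i j p.1 p.2 * vertU t g k l p.1 p.2) * vert t (pdh a b g) p.1 p.2 ≤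
      ENNReal.ofReal (2 * nrmA t g a b * coeffK t σ g i j k l) := by
  have hG := normH_vert_pdh hg hc (n := (i + j) + (k + l)) (a := a) (b := b) (by omega)
  have mG := measurable_vert (t := t) (hg.pdh a b)
  have hn := nrmA_nonneg (f := g) (t := t) a b
  rw [show a + b = (i + j) + (k + l) by omega, coeffK]
  split_ifs
  · refine (lintegral_trilinear_le (measurable_vertU hg k l) mG
      (angR_mul_vertF_le hg hσ hc hz i j)).trans ?_
    rw [hG]
    refine (mul_le_mul_right (mul_le_mul_left (normH_vertU_le hg hc k l) _) _).trans_eq ?_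
    have h1 := squareSum_nonneg (shearSum_nonneg (g := g) (t := t) hσ) i j
    rw [ENNReal.ofReal_mul (by positivity), ENNReal.ofReal_mul (by positivity),
      ENNReal.ofReal_mul h1]
    norm_num
    ring
  · rw [add_comm (i + j)] at hG ⊢
    simp only [mul_comm (vertF t σ g i j _ _)]
    refine (lintegral_trilinear_le (measurable_vertF hg i j) mG
      (angR_mul_vertU_le hg hc k l)).trans ?_
    rw [hG]
    refine (mul_le_mul_right (mul_le_mul_left (normH_vertF_le hg hσ hc hz i j) _) _).trans_eq ?_
    have h1 := shearSum_nonneg (g := g) (t := t) hσ i j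
    rw [ENNReal.ofReal_mul (by positivity), ENNReal.ofReal_mul (by positivity),
      ENNReal.ofReal_mul h1]
    norm_num
    ring

lemma leib_mono_of_mem {a b : ℕ} {K L : ℕ → ℕ → ℕ → ℕ → ℝ≥0∞}
    (h : ∀ i j k l, i + k = a → j + l = b → K i j k l ≤ L i j k l) :
    leib a b K ≤ leib a b L :=
  Finset.sum_le_sum fun _ hq => Finset.sum_le_sum fun _ hp =>
    mul_le_mul_right (h _ _ _ _ (Finset.HasAntidiagonal.mem_antidiagonal.1 hp)
      (Finset.HasAntidiagonal.mem_antidiagonal.1 hq)) _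

lemma leib_nonneg (a b : ℕ) {K : ℕ → ℕ → ℕ → ℕ → ℝ} (hK : ∀ i j k l, 0 ≤ K i j k l) :
    0 ≤ leib a b K :=
  Finset.sum_nonneg fun _ _ => Finset.sum_nonneg fun _ _ => mul_nonneg (Nat.cast_nonneg _) (hK _ _ _ _)

lemma leib_ofReal (a b : ℕ) {K : ℕ → ℕ → ℕ → ℕ → ℝ} (hK : ∀ i j k l, 0 ≤ K i j k l) :
    leib a b (fun i j k l => ENNReal.ofReal (K i j k l)) = ENNReal.ofReal (leib a b K) := by
  unfold leib
  rw [ENNReal.ofReal_sum_of_nonneg fun _ _ => Finset.sum_nonneg fun _ _ =>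
    mul_nonneg (Nat.cast_nonneg _) (hK _ _ _ _)]
  refine Finset.sum_congr rfl fun q _ => ?_
  rw [ENNReal.ofReal_sum_of_nonneg fun _ _ => mul_nonneg (Nat.cast_nonneg _) (hK _ _ _ _)]
  refine Finset.sum_congr rfl fun p _ => ?_
  rw [ENNReal.ofReal_mul (Nat.cast_nonneg _), ENNReal.ofReal_natCast]

lemma abs_I7_le (hg : Smooth3 g) (hσ : 0 < σ) (hw : angT t = σ ^ 4) (hc : L2cond t g)
    (hz : L2condZ t g) (a b : ℕ) :
    |I7 t g a b| ≤ 19200 * leib a b (coeffK t σ g) * nrmA t g a b := by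
  have hK : ∀ i j k l, 0 ≤ coeffK t σ g i j k l := coeffK_nonneg hσ
  have hn := nrmA_nonneg (f := g) (t := t) a b
  have hL := leib_nonneg a b hK
  have mF := fun i j => measurable_vertF (t := t) (σ := σ) hg i j
  have mU := fun i j => measurable_vertU (t := t) hg i j
  have mG := measurable_vert (t := t) (hg.pdh a b)
  have mK : ∀ i j k l, Measurable fun p : ℝ × ℝ => ENNReal.ofReal (angR p.1 p.2) ^ (2 * (a + b)) *
      (vertF t σ g i j p.1 p.2 * vertU t g k l p.1 p.2) * vert t (pdh a b g) p.1 p.2 :=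
    fun i j k l => ((measurable_angR.pow_const _).mul ((mF i j).mul (mU k l))).mul mG
  have key : ‖trip fun x y z => z * thw t 2 z * angR x y ^ (2 * (a + b)) *
      (∫ s in Ioi z, pdh a b (fun x' y' z' => pdz (ur t g) x' y' z' * uzv t g x' y' z') x y s) *
        pdh a b g x y z‖ₑ ≤
      ENNReal.ofReal (9600 * σ ^ 4 * (2 * nrmA t g a b * leib a b (coeffK t σ g))) := by
    calc _ ≤ ∫⁻ x : ℝ, ∫⁻ y : ℝ, ENNReal.ofReal (9600 * σ ^ 4) *
          leib a b fun i j k l => ENNReal.ofReal (angR x y) ^ (2 * (a + b)) *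
            (vertF t σ g i j x y * vertU t g k l x y) * vert t (pdh a b g) x y := by
          refine (enorm_integral_le_lintegral_enorm _).trans (lintegral_mono fun x => ?_)
          refine (enorm_integral_le_lintegral_enorm _).trans (lintegral_mono fun y => ?_)
          refine (enorm_integral_le_lintegral_enorm _).trans ?_
          refine (lintegral_vertical_le hg hσ hw a b x y).trans_eq ?_
          rw [mul_right_comm (ENNReal.ofReal (angR x y) ^ _), mul_leib]
          congr 2
          funext i j k l
          ring
      _ = ∫⁻ p : ℝ × ℝ, ENNReal.ofReal (9600 * σ ^ 4) *
          leib a b fun i j k l => ENNReal.ofReal (angR p.1 p.2) ^ (2 * (a + b)) *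
            (vertF t σ g i j p.1 p.2 * vertU t g k l p.1 p.2) * vert t (pdh a b g) p.1 p.2 := by
          rw [Measure.volume_eq_prod, lintegral_prod]
          refine (Measurable.const_mul ?_ _).aemeasurable
          exact Finset.measurable_fun_sum _ fun q _ => Finset.measurable_fun_sum _ fun p _ =>
            (mK _ _ _ _).const_mul _
      _ = ENNReal.ofReal (9600 * σ ^ 4) * leib a b fun i j k l =>
          ∫⁻ p : ℝ × ℝ, ENNReal.ofReal (angR p.1 p.2) ^ (2 * (a + b)) *
            (vertF t σ g i j p.1 p.2 * vertU t g k l p.1 p.2) * vert t (pdh a b g) p.1 p.2 := by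
          rw [lintegral_const_mul' _ _ ENNReal.ofReal_ne_top, lintegral_leib a b mK]
      _ ≤ ENNReal.ofReal (9600 * σ ^ 4) * leib a b fun i j k l =>
          ENNReal.ofReal (2 * nrmA t g a b * coeffK t σ g i j k l) := by
          gcongr
          exact leib_mono_of_mem fun i j k l ha hb => lintegral_coeffK_le hg hσ hc hz ha hb
      _ = _ := by
          rw [leib_ofReal a b fun i j k l => mul_nonneg (by positivity) (hK i j k l), ← mul_leib,
            ← ENNReal.ofReal_mul (by positivity)]
  rw [Real.enorm_eq_ofReal_abs, ENNReal.ofReal_le_ofReal_iff (by positivity)] at key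
  rw [I7, hw, abs_mul, abs_of_pos (by positivity)]
  calc _ ≤ 1 / σ ^ 4 * (9600 * σ ^ 4 * (2 * nrmA t g a b * leib a b (coeffK t σ g))) := by
        gcongr
    _ = _ := by
        field_simp
        ring

end core

end

/-- The sum of `p` over the multi-indices of order `n`. -/
def levelSum (p : ℕ → ℕ → ℝ) (n : ℕ) : ℝ := ∑ a ∈ Finset.range (n + 1), p a (n - a)

lemma levelSum_eq (p : ℕ → ℕ → ℝ) (n : ℕ) :
    levelSum p n = ∑ q ∈ Finset.HasAntidiagonal.antidiagonal n, p q.1 q.2 :=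
  (Finset.Nat.sum_antidiagonal_eq_sum_range_succ p n).symm

lemma levelSum_nonneg {p : ℕ → ℕ → ℝ} (hp : ∀ a b, 0 ≤ p a b) (n : ℕ) : 0 ≤ levelSum p n :=
  Finset.sum_nonneg fun _ _ => hp _ _

lemma levelSum_mono {p q : ℕ → ℕ → ℝ} {n : ℕ} (h : ∀ a b, a + b = n → p a b ≤ q a b) :
    levelSum p n ≤ levelSum q n :=
  Finset.sum_le_sum fun a ha => h _ _ (by have := Finset.mem_range.1 ha; omega)

lemma levelSum_add (p q : ℕ → ℕ → ℝ) (n : ℕ) :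
    levelSum (fun a b => p a b + q a b) n = levelSum p n + levelSum q n :=
  Finset.sum_add_distrib

lemma levelSum_mul_left (c : ℝ) (p : ℕ → ℕ → ℝ) (n : ℕ) :
    levelSum (fun a b => c * p a b) n = c * levelSum p n :=
  (Finset.mul_sum _ _ _).symm

lemma levelSum_shift_fst_le {p : ℕ → ℕ → ℝ} (hp : ∀ a b, 0 ≤ p a b) (n : ℕ) :
    levelSum (fun a b => p (a + 1) b) n ≤ levelSum p (n + 1) := by
  rw [levelSum_eq, levelSum_eq, Finset.Nat.sum_antidiagonal_succ]
  linarith [hp 0 (n + 1)]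

lemma levelSum_shift_snd_le {p : ℕ → ℕ → ℝ} (hp : ∀ a b, 0 ≤ p a b) (n : ℕ) :
    levelSum (fun a b => p a (b + 1)) n ≤ levelSum p (n + 1) := by
  rw [levelSum_eq, levelSum_eq, Finset.Nat.sum_antidiagonal_succ']
  linarith [hp (n + 1) 0]

lemma levelSum_squareSum_le {p : ℕ → ℕ → ℝ} (hp : ∀ a b, 0 ≤ p a b) (n : ℕ) :
    levelSum (squareSum p) n ≤ levelSum p n + 2 * levelSum p (n + 1) + levelSum p (n + 2) := by
  have h1 := levelSum_shift_snd_le hp n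
  have h2 := levelSum_shift_fst_le hp n
  have h3 := (levelSum_shift_fst_le (p := fun a b => p a (b + 1)) (fun a b => hp _ _) n).trans
    (levelSum_shift_snd_le hp (n + 1))
  have h : levelSum (squareSum p) n = levelSum p n + levelSum (fun a b => p a (b + 1)) n +
      (levelSum (fun a b => p (a + 1) b) n + levelSum (fun a b => p (a + 1) (b + 1)) n) := by
    rw [← levelSum_add, ← levelSum_add, ← levelSum_add]; rfl
  linarith

lemma levelSum_velSum_le {p : ℕ → ℕ → ℝ} (hp : ∀ a b, 0 ≤ p a b) (n : ℕ) :
    levelSum (velSum p) n ≤ 2 * levelSum p (n + 1) + (n + 2) * levelSum p n := by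
  have h1 := levelSum_shift_snd_le hp n
  have h2 := levelSum_shift_fst_le hp n
  have h : levelSum (velSum p) n = levelSum (fun a b => p (a + 1) b) n +
      levelSum (fun a b => p a (b + 1)) n + (n + 2) * levelSum p n := by
    rw [← levelSum_mul_left, ← levelSum_add, ← levelSum_add]
    refine Finset.sum_congr rfl fun a ha => ?_
    have : ((a : ℝ) + ((n - a : ℕ) : ℝ)) = n := by
      have := Finset.mem_range.1 ha
      exact_mod_cast (by omega : a + (n - a) = n)
    simp only [velSum, this]
  linarith

lemma choose_mul_choose_le (a b i j : ℕ) :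
    a.choose i * b.choose j ≤ (a + b).choose (i + j) := by
  rw [Nat.add_choose_eq]
  exact Finset.single_le_sum (f := fun ij : ℕ × ℕ => a.choose ij.1 * b.choose ij.2)
    (fun _ _ => Nat.zero_le _) (a := (i, j)) (Finset.HasAntidiagonal.mem_antidiagonal.2 rfl)

lemma levelSum_leib_le {K : ℕ → ℕ → ℕ → ℕ → ℝ} (hK : ∀ i j k l, 0 ≤ K i j k l) (n : ℕ) :
    levelSum (fun a b => leib a b K) n ≤
      levelSum (fun j m => (n.choose j : ℝ) *
        levelSum (fun i i' => levelSum (fun k k' => K i i' k k') m) j) n := by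
  simp only [levelSum_eq, leib, Finset.mul_sum, Finset.sum_sigma']
  refine (Finset.sum_nbij' (t := (Finset.HasAntidiagonal.antidiagonal n).sigma fun q =>
      (Finset.HasAntidiagonal.antidiagonal q.1).sigma fun _ =>
        Finset.HasAntidiagonal.antidiagonal q.2)
    (g := fun x => (((x.2.1.2 + x.2.2.2).choose x.2.1.2 *
      (x.2.1.1 + x.2.2.1).choose x.2.1.1 : ℕ) : ℝ) * K x.2.1.1 x.2.1.2 x.2.2.1 x.2.2.2)
    (fun x => ⟨(x.2.2.1 + x.2.1.1, x.2.2.2 + x.2.1.2), ⟨(x.2.2.1, x.2.1.1), (x.2.2.2, x.2.1.2)⟩⟩)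
    (fun x => ⟨(x.2.1.1 + x.2.2.1, x.2.1.2 + x.2.2.2), ⟨(x.2.1.2, x.2.2.2), (x.2.1.1, x.2.2.1)⟩⟩)
    ?_ ?_ ?_ ?_ ?_).trans_le (Finset.sum_le_sum fun x hx => ?_)
  · rintro ⟨⟨a, b⟩, ⟨⟨c, d⟩, ⟨e, f⟩⟩⟩ h
    simp only [Finset.mem_sigma, Finset.HasAntidiagonal.mem_antidiagonal, and_true] at h ⊢
    omega
  · rintro ⟨⟨a, b⟩, ⟨⟨c, d⟩, ⟨e, f⟩⟩⟩ h
    simp only [Finset.mem_sigma, Finset.HasAntidiagonal.mem_antidiagonal, and_true] at h ⊢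
    omega
  · rintro ⟨⟨a, b⟩, ⟨⟨c, d⟩, ⟨e, f⟩⟩⟩ h
    simp only [Finset.mem_sigma, Finset.HasAntidiagonal.mem_antidiagonal] at h ⊢
    obtain ⟨h1, h2, h3⟩ := h
    subst h2 h3
    rfl
  · rintro ⟨⟨a, b⟩, ⟨⟨c, d⟩, ⟨e, f⟩⟩⟩ h
    simp only [Finset.mem_sigma, Finset.HasAntidiagonal.mem_antidiagonal] at h ⊢
    obtain ⟨h1, h2, h3⟩ := h
    subst h2 h3
    rfl
  · rintro ⟨⟨a, b⟩, ⟨⟨c, d⟩, ⟨e, f⟩⟩⟩ h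
    simp only [Finset.mem_sigma, Finset.HasAntidiagonal.mem_antidiagonal] at h ⊢
    obtain ⟨h1, h2, h3⟩ := h
    subst h2 h3
    rfl
  · obtain ⟨⟨a, b⟩, ⟨⟨c, d⟩, ⟨e, f⟩⟩⟩ := x
    simp only [Finset.mem_sigma, Finset.HasAntidiagonal.mem_antidiagonal] at hx ⊢
    obtain ⟨h1, h2, h3⟩ := hx
    refine mul_le_mul_of_nonneg_right ?_ (hK _ _ _ _)
    have h := choose_mul_choose_le (d + f) (c + e) d c
    rw [show d + f + (c + e) = n by omega, show d + c = a by omega] at h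
    exact_mod_cast h

lemma levelSum_levelSum_mul (p q : ℕ → ℕ → ℝ) (j m : ℕ) :
    levelSum (fun i i' => levelSum (fun k k' => p i i' * q k k') m) j =
      levelSum p j * levelSum q m := by
  simp only [levelSum, Finset.sum_mul_sum]

lemma levelSum_coeffK {t σ : ℝ} {g : ℝ → ℝ → ℝ → ℝ} (j m : ℕ) :
    levelSum (fun i i' => levelSum (fun k k' => coeffK t σ g i i' k k') m) j =
      if j ≤ m then levelSum (squareSum (shearSum t σ g)) j * levelSum (velSum (nrmA t g)) m
      else levelSum (shearSum t σ g) j * levelSum (velSum (squareSum (nrmA t g))) m := by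
  have h : ∀ i ∈ Finset.range (j + 1), ∀ k ∈ Finset.range (m + 1),
      coeffK t σ g i (j - i) k (m - k) =
        if j ≤ m then squareSum (shearSum t σ g) i (j - i) * velSum (nrmA t g) k (m - k)
        else shearSum t σ g i (j - i) * velSum (squareSum (nrmA t g)) k (m - k) := by
    intro i hi k hk
    have h1 := Finset.mem_range.1 hi
    have h2 := Finset.mem_range.1 hk
    simp only [coeffK, show i + (j - i) = j by omega, show k + (m - k) = m by omega]
  split_ifs with hjm
  · rw [← levelSum_levelSum_mul]
    exact Finset.sum_congr rfl fun i hi => Finset.sum_congr rfl fun k hk =>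
      (h i hi k hk).trans (if_pos hjm)
  · rw [← levelSum_levelSum_mul]
    exact Finset.sum_congr rfl fun i hi => Finset.sum_congr rfl fun k hk =>
      (h i hi k hk).trans (if_neg hjm)

lemma mfac_nonneg (n : ℕ) : 0 ≤ Mfac n := by unfold Mfac; positivity

lemma mfac_mul_choose (j m : ℕ) (τ : ℝ) :
    τ ^ (j + m) * Mfac (j + m) * ((j + m).choose j : ℝ) =
      ((j : ℝ) + m + 1) ^ 4 * (τ ^ j / j.factorial) * (τ ^ m / m.factorial) := by
  have h := Nat.add_choose_mul_factorial_mul_factorial j m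
  have h' : (((j + m).choose j : ℕ) : ℝ) * j.factorial * m.factorial = (j + m).factorial := by
    rw [Nat.choose_symm_add]
    exact_mod_cast h
  have h1 : (j.factorial : ℝ) ≠ 0 := by positivity
  have h2 : (m.factorial : ℝ) ≠ 0 := by positivity
  rw [Mfac, ← h']
  have h3 : (((j + m).choose j : ℕ) : ℝ) ≠ 0 := by
    have := Nat.choose_pos (Nat.le_add_right j m)
    positivity
  push_cast
  field_simp
  ring

/-- The weight `τⁿ / n!`. -/
def expWeight (τ : ℝ) (n : ℕ) : ℝ := τ ^ n / n.factorial

/-- A level sequence weighted by `τⁿ Mₙ`. -/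
def wX (τ : ℝ) (p : ℕ → ℝ) (n : ℕ) : ℝ := p n * τ ^ n * Mfac n

/-- A level sequence weighted by `n τⁿ⁻¹ Mₙ`. -/
def wY (τ : ℝ) (p : ℕ → ℝ) (n : ℕ) : ℝ := p n * τ ^ (n - 1) * n * Mfac n

section weights

variable {τ : ℝ} {p : ℕ → ℝ}

lemma wX_nonneg (hτ : 0 < τ) (hp : ∀ n, 0 ≤ p n) (n : ℕ) : 0 ≤ wX τ p n :=
  mul_nonneg (mul_nonneg (hp n) (by positivity)) (mfac_nonneg n)

lemma wY_nonneg (hτ : 0 < τ) (hp : ∀ n, 0 ≤ p n) (n : ℕ) : 0 ≤ wY τ p n :=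
  mul_nonneg (mul_nonneg (mul_nonneg (hp n) (by positivity)) (by positivity)) (mfac_nonneg n)

lemma wX_eq (n : ℕ) : ((n : ℝ) + 1) ^ 4 * (p n * expWeight τ n) = wX τ p n := by
  unfold wX expWeight Mfac; ring

lemma mul_wY (n : ℕ) : n * wX τ p n = τ * wY τ p n := by
  unfold wX wY
  cases n with
  | zero => simp
  | succ n => simp only [Nat.add_sub_cancel]; ring

lemma expWeight_succ (n : ℕ) : ((n : ℝ) + 1) * expWeight τ (n + 1) = τ * expWeight τ n := by
  unfold expWeight
  rw [Nat.factorial_succ]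
  push_cast
  field_simp
  ring

lemma wY_eq (hτ : 0 < τ) (n : ℕ) :
    ((n : ℝ) + 2) ^ 4 * (p (n + 1) * expWeight τ n) = wY τ p (n + 1) := by
  have h := mul_wY (τ := τ) (p := p) (n + 1)
  rw [← wX_eq] at h
  have h2 := expWeight_succ (τ := τ) n
  push_cast at h
  have : τ * (((n : ℝ) + 2) ^ 4 * (p (n + 1) * expWeight τ n)) = τ * wY τ p (n + 1) := by
    rw [← h]; linear_combination (-((n : ℝ) + 2) ^ 4 * p (n + 1)) * h2
  exact mul_left_cancel₀ hτ.ne' this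

lemma expWeight_nonneg (hτ : 0 < τ) (n : ℕ) : 0 ≤ expWeight τ n := by
  unfold expWeight; positivity

lemma weight_le_wX (hτ : 0 < τ) (hp : ∀ n, 0 ≤ p n) (n : ℕ) :
    p n * expWeight τ n ≤ wX τ p n := by
  rw [← wX_eq]
  refine le_mul_of_one_le_left (mul_nonneg (hp n) (expWeight_nonneg hτ n)) ?_
  exact one_le_pow₀ (by linarith [(Nat.cast_nonneg n : (0 : ℝ) ≤ n)])

lemma succ_mul_weight_le_wX (hτ : 0 < τ) (hp : ∀ n, 0 ≤ p n) (n : ℕ) :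
    (n + 1) * (p n * expWeight τ n) ≤ wX τ p n := by
  rw [← wX_eq]
  refine mul_le_mul_of_nonneg_right ?_ (mul_nonneg (hp n) (expWeight_nonneg hτ n))
  exact le_self_pow₀ (by linarith [(Nat.cast_nonneg n : (0 : ℝ) ≤ n)]) (by norm_num)

lemma sq_mul_weight_le_wX (hτ : 0 < τ) (hp : ∀ n, 0 ≤ p n) (n : ℕ) :
    (n + 1) ^ 2 * (p n * expWeight τ n) ≤ wX τ p n := by
  rw [← wX_eq]
  refine mul_le_mul_of_nonneg_right ?_ (mul_nonneg (hp n) (expWeight_nonneg hτ n))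
  exact pow_le_pow_right₀ (by linarith [(Nat.cast_nonneg n : (0 : ℝ) ≤ n)]) (by norm_num)

/-- shifting the weight by one index costs `τ⁻¹` -/
lemma weight_shift_one_le (hτ : 0 < τ) (hp : ∀ n, 0 ≤ p n) (n : ℕ) :
    τ * (p (n + 1) * expWeight τ n) ≤ wX τ p (n + 1) := by
  have h := succ_mul_weight_le_wX hτ hp (n + 1)
  have h2 := expWeight_succ (τ := τ) n
  have h3 := mul_nonneg (hp (n + 1)) (expWeight_nonneg hτ (n + 1))
  push_cast at h
  calc _ = p (n + 1) * (τ * expWeight τ n) := by ring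
    _ = (n + 1) * (p (n + 1) * expWeight τ (n + 1)) := by rw [← h2]; ring
    _ ≤ _ := by linarith

lemma weight_shift_two_le (hτ : 0 < τ) (hp : ∀ n, 0 ≤ p n) (n : ℕ) :
    τ ^ 2 * (p (n + 2) * expWeight τ n) ≤ wX τ p (n + 2) := by
  have h := sq_mul_weight_le_wX hτ hp (n + 2)
  have h2 := expWeight_succ (τ := τ) n
  have h2' := expWeight_succ (τ := τ) (n + 1)
  have h3 := mul_nonneg (hp (n + 2)) (expWeight_nonneg hτ (n + 2))
  push_cast at h h2'
  have hn : (0 : ℝ) ≤ n := Nat.cast_nonneg n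
  calc _ = p (n + 2) * (τ * (τ * expWeight τ n)) := by ring
    _ = p (n + 2) * ((n + 1) * (τ * expWeight τ (n + 1))) := by rw [← h2]; ring
    _ = (n + 1) * (n + 2) * (p (n + 2) * expWeight τ (n + 2)) := by rw [← h2']; ring
    _ ≤ (n + 2 + 1) ^ 2 * (p (n + 2) * expWeight τ (n + 2)) := by
      refine mul_le_mul_of_nonneg_right ?_ h3; nlinarith
    _ ≤ _ := h

lemma pow_mul_weight_le_wY (hτ : 0 < τ) (hp : ∀ n, 0 ≤ p n) (n : ℕ) :
    ((n : ℝ) + 1) ^ 4 * (p (n + 1) * expWeight τ n) ≤ wY τ p (n + 1) := by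
  rw [← wY_eq hτ]
  have := mul_nonneg (hp (n + 1)) (expWeight_nonneg hτ n)
  gcongr
  norm_num

lemma add_two_mul_weight_le_wY (hτ : 0 < τ) (hp : ∀ n, 0 ≤ p n) (n : ℕ) :
    ((n : ℝ) + 2) * (p (n + 1) * expWeight τ n) ≤ wY τ p (n + 1) := by
  rw [← wY_eq hτ]
  refine mul_le_mul_of_nonneg_right ?_ (mul_nonneg (hp (n + 1)) (expWeight_nonneg hτ n))
  exact le_self_pow₀ (by linarith [(Nat.cast_nonneg n : (0 : ℝ) ≤ n)]) (by norm_num)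

lemma add_two_mul_weight_shift_le_wY (hτ : 0 < τ) (hp : ∀ n, 0 ≤ p n) (n : ℕ) :
    τ * (((n : ℝ) + 2) * (p (n + 2) * expWeight τ n)) ≤ wY τ p (n + 2) := by
  have h2 := expWeight_succ (τ := τ) n
  have h3 := mul_nonneg (hp (n + 2)) (expWeight_nonneg hτ (n + 1))
  have hn : (0 : ℝ) ≤ n := Nat.cast_nonneg n
  rw [← wY_eq hτ]
  push_cast
  calc _ = (n + 2) * (p (n + 2) * (τ * expWeight τ n)) := by ring
    _ = (n + 1) * (n + 2) * (p (n + 2) * expWeight τ (n + 1)) := by rw [← h2]; ring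
    _ ≤ ((n : ℝ) + 1 + 2) ^ 2 * (p (n + 2) * expWeight τ (n + 1)) := by
      refine mul_le_mul_of_nonneg_right ?_ h3; nlinarith
    _ ≤ _ := mul_le_mul_of_nonneg_right
      (pow_le_pow_right₀ (by linarith) (by norm_num)) h3

lemma weight_shift_three_le_wY (hτ : 0 < τ) (hp : ∀ n, 0 ≤ p n) (n : ℕ) :
    τ ^ 2 * (p (n + 3) * expWeight τ n) ≤ wY τ p (n + 3) := by
  have h2 := expWeight_succ (τ := τ) n
  have h2' := expWeight_succ (τ := τ) (n + 1)
  have h3 := mul_nonneg (hp (n + 3)) (expWeight_nonneg hτ (n + 2))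
  have hn : (0 : ℝ) ≤ n := Nat.cast_nonneg n
  rw [← wY_eq hτ]
  push_cast at h2' ⊢
  calc _ = p (n + 3) * (τ * (τ * expWeight τ n)) := by ring
    _ = p (n + 3) * ((n + 1) * (τ * expWeight τ (n + 1))) := by rw [← h2]; ring
    _ = (n + 1) * (n + 2) * (p (n + 3) * expWeight τ (n + 2)) := by rw [← h2']; ring
    _ ≤ ((n : ℝ) + 2 + 2) ^ 2 * (p (n + 3) * expWeight τ (n + 2)) := by
      refine mul_le_mul_of_nonneg_right ?_ h3; nlinarith
    _ ≤ _ := mul_le_mul_of_nonneg_right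
      (pow_le_pow_right₀ (by linarith) (by norm_num)) h3

lemma add_two_mul_wX (n : ℕ) :
    ((n : ℝ) + 2) * wX τ p n = 2 * wX τ p n + τ * wY τ p n := by
  rw [← mul_wY]; ring

lemma add_two_mul_weight_le (hτ : 0 < τ) (hp : ∀ n, 0 ≤ p n) (n : ℕ) :
    ((n : ℝ) + 2) * (p n * expWeight τ n) ≤ 2 * wX τ p n + τ * wY τ p n := by
  rw [← add_two_mul_wX]
  exact mul_le_mul_of_nonneg_left (weight_le_wX hτ hp n) (by positivity)

end weights

/-- Three consecutive terms of the weighted sequence. -/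
def window (τ : ℝ) (q : ℕ → ℝ) (j : ℕ) : ℝ := wX τ q j + wX τ q (j + 1) + wX τ q (j + 2)

/-- Consecutive terms of the two weighted sequences. -/
def windowXY (τ : ℝ) (p : ℕ → ℝ) (m : ℕ) : ℝ :=
  wX τ p m + wY τ p m + wY τ p (m + 1) + wY τ p (m + 2) + wY τ p (m + 3)

section terms

variable {τ τ₀ : ℝ} {p q : ℕ → ℝ}

lemma window_nonneg (hτ : 0 < τ) (hq : ∀ n, 0 ≤ q n) (j : ℕ) : 0 ≤ window τ q j := by
  have h := wX_nonneg hτ hq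
  exact add_nonneg (add_nonneg (h _) (h _)) (h _)

lemma windowXY_nonneg (hτ : 0 < τ) (hp : ∀ n, 0 ≤ p n) (m : ℕ) : 0 ≤ windowXY τ p m := by
  have h := wX_nonneg hτ hp
  have h' := wY_nonneg hτ hp
  exact add_nonneg (add_nonneg (add_nonneg (add_nonneg (h _) (h' _)) (h' _)) (h' _)) (h' _)

lemma wX_pow_mul_le_window (hτ : 0 < τ) (hq : ∀ n, 0 ≤ q n) (j : ℕ) :
    ((j : ℝ) + 1) ^ 4 * (q j * expWeight τ j) ≤ window τ q j := by
  have h := wX_nonneg hτ hq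
  rw [wX_eq, window]
  linarith [h (j + 1), h (j + 2)]

lemma square_mul_weight_le (hτ : 0 < τ) (hτ₀ : τ ≤ τ₀) (hq : ∀ n, 0 ≤ q n) (j : ℕ) :
    τ ^ 2 * ((q j + 2 * q (j + 1) + q (j + 2)) * expWeight τ j) ≤
      2 * (1 + τ₀) ^ 2 * window τ q j := by
  have h0 := weight_le_wX hτ hq j
  have h1 := weight_shift_one_le hτ hq j
  have h2 := weight_shift_two_le hτ hq j
  have n := wX_nonneg hτ hq
  have e0 : τ ^ 2 * (q j * expWeight τ j) ≤ (1 + τ₀) ^ 2 * wX τ q j :=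
    mul_le_mul (by nlinarith) h0 (mul_nonneg (hq j) (expWeight_nonneg hτ j)) (by positivity)
  have e1 : τ * (τ * (q (j + 1) * expWeight τ j)) ≤ (1 + τ₀) ^ 2 * wX τ q (j + 1) :=
    mul_le_mul (by nlinarith) h1
      (mul_nonneg hτ.le (mul_nonneg (hq _) (expWeight_nonneg hτ j))) (by positivity)
  have e2 : wX τ q (j + 2) ≤ (1 + τ₀) ^ 2 * wX τ q (j + 2) :=
    le_mul_of_one_le_left (n _) (by nlinarith)
  have e3 : 0 ≤ (1 + τ₀) ^ 2 * wX τ q j := mul_nonneg (by positivity) (n _)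
  have e4 := n (j + 2)
  unfold window
  linarith

lemma vel_mul_weight_le (hτ : 0 < τ) (hτ₀ : τ ≤ τ₀) (hp : ∀ n, 0 ≤ p n) (m : ℕ) :
    ((m : ℝ) + 1) ^ 4 * ((2 * p (m + 1) + (m + 2) * p m) * expWeight τ m) ≤
      (2 + τ₀) * windowXY τ p m := by
  have h1 := pow_mul_weight_le_wY hτ hp m
  have h2 := wX_eq (τ := τ) (p := p) m
  have h3 := add_two_mul_wX (τ := τ) (p := p) m
  have nX := wX_nonneg hτ hp m
  have nY := wY_nonneg hτ hp
  have e1 : τ * wY τ p m ≤ τ₀ * wY τ p m := mul_le_mul_of_nonneg_right hτ₀ (nY m)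
  have hτ₀' : 0 ≤ τ₀ := hτ.le.trans hτ₀
  calc _ = 2 * (((m : ℝ) + 1) ^ 4 * (p (m + 1) * expWeight τ m)) +
        (m + 2) * (((m : ℝ) + 1) ^ 4 * (p m * expWeight τ m)) := by ring
    _ ≤ 2 * wY τ p (m + 1) + (2 * wX τ p m + τ₀ * wY τ p m) := by rw [h2, h3]; linarith
    _ ≤ _ := by
      unfold windowXY
      nlinarith [mul_nonneg hτ₀' nX, mul_nonneg hτ₀' (nY m), mul_nonneg hτ₀' (nY (m + 1)),
        mul_nonneg hτ₀' (nY (m + 2)), mul_nonneg hτ₀' (nY (m + 3)), nY m, nY (m + 1), nY (m + 2),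
        nY (m + 3)]

lemma vel_square_mul_weight_le (hτ : 0 < τ) (hτ₀ : τ ≤ τ₀) (hp : ∀ n, 0 ≤ p n) (m : ℕ) :
    τ ^ 2 * ((2 * (p (m + 1) + 2 * p (m + 2) + p (m + 3)) +
        (m + 2) * (p m + 2 * p (m + 1) + p (m + 2))) * expWeight τ m) ≤
      5 * (1 + τ₀) ^ 3 * windowXY τ p m := by
  have nX := wX_nonneg hτ hp m
  have nY := wY_nonneg hτ hp
  have hm : (0 : ℝ) ≤ m := Nat.cast_nonneg m
  have w1 := mul_nonneg (hp (m + 1)) (expWeight_nonneg hτ m)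
  have w2 := mul_nonneg hτ.le (mul_nonneg (hp (m + 2)) (expWeight_nonneg hτ m))
  have h0 := add_two_mul_weight_le hτ hp m
  have h1 := add_two_mul_weight_le_wY hτ hp m
  have h2 := add_two_mul_weight_shift_le_wY hτ hp m
  have h3 := weight_shift_three_le_wY hτ hp m
  have k1 : 2 * (p (m + 1) * expWeight τ m) ≤ wY τ p (m + 1) :=
    (mul_le_mul_of_nonneg_right (by linarith) w1).trans h1
  have k2 : 2 * (τ * (p (m + 2) * expWeight τ m)) ≤ wY τ p (m + 2) := by
    linarith [mul_nonneg hm w2]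
  have c0 : (1 : ℝ) ≤ (1 + τ₀) ^ 3 := one_le_pow₀ (by linarith)
  have c1 : τ ≤ (1 + τ₀) ^ 3 :=
    (by linarith : τ ≤ 1 + τ₀).trans (le_self_pow₀ (by linarith) (by norm_num))
  have c2 : τ ^ 2 ≤ (1 + τ₀) ^ 3 :=
    (pow_le_pow_left₀ hτ.le (by linarith) 2).trans (pow_le_pow_right₀ (by linarith) (by norm_num))
  have c3 : τ ^ 3 ≤ (1 + τ₀) ^ 3 := pow_le_pow_left₀ hτ.le (by linarith) 3
  set Cτ := (1 + τ₀) ^ 3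
  have b0 := mul_le_mul_of_nonneg_right c2 nX
  have b1 := mul_le_mul_of_nonneg_right c3 (nY m)
  have b2 := mul_le_mul_of_nonneg_right c2 (nY (m + 1))
  have b3 := mul_le_mul_of_nonneg_right c1 (nY (m + 2))
  have b4 := mul_le_mul_of_nonneg_right c0 (nY (m + 3))
  have m0 := mul_le_mul_of_nonneg_left h0 (sq_nonneg τ)
  have m1 := mul_le_mul_of_nonneg_left h1 (sq_nonneg τ)
  have m2 := mul_le_mul_of_nonneg_left h2 hτ.le
  have m3 := mul_le_mul_of_nonneg_left k1 (sq_nonneg τ)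
  have m4 := mul_le_mul_of_nonneg_left k2 hτ.le
  have z : ∀ x, 0 ≤ x → 0 ≤ Cτ * x := fun x hx => mul_nonneg (by linarith) hx
  have z0 := z _ nX
  have z1 := z _ (nY m)
  have z2 := z _ (nY (m + 1))
  have z3 := z _ (nY (m + 2))
  have z4 := z _ (nY (m + 3))
  unfold windowXY
  calc _ = τ ^ 2 * (2 * (p (m + 1) * expWeight τ m)) +
        2 * (τ * (2 * (τ * (p (m + 2) * expWeight τ m)))) +
        2 * (τ ^ 2 * (p (m + 3) * expWeight τ m)) +
        τ ^ 2 * ((m + 2) * (p m * expWeight τ m)) +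
        2 * (τ ^ 2 * ((m + 2) * (p (m + 1) * expWeight τ m))) +
        τ * (τ * ((m + 2) * (p (m + 2) * expWeight τ m))) := by ring
    _ ≤ τ ^ 2 * wY τ p (m + 1) + 2 * (τ * wY τ p (m + 2)) + 2 * wY τ p (m + 3) +
        τ ^ 2 * (2 * wX τ p m + τ * wY τ p m) + 2 * (τ ^ 2 * wY τ p (m + 1)) +
        τ * wY τ p (m + 2) := by linarith
    _ ≤ _ := by linarith

lemma add_add_one_pow_le {j m : ℕ} (h : j ≤ m) :
    ((j : ℝ) + m + 1) ^ 4 ≤ 16 * ((m : ℝ) + 1) ^ 4 := by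
  have h' : (j : ℝ) ≤ m := by exact_mod_cast h
  calc _ ≤ (2 * ((m : ℝ) + 1)) ^ 4 := pow_le_pow_left₀ (by positivity) (by linarith) 4
    _ = _ := by ring

lemma weighted_product_le (hτ : 0 < τ) (hτ₀ : τ ≤ τ₀) (hp : ∀ n, 0 ≤ p n) (hq : ∀ n, 0 ≤ q n)
    (j m : ℕ) :
    τ ^ (j + m) * Mfac (j + m) * ((j + m).choose j : ℝ) *
      (if j ≤ m then (q j + 2 * q (j + 1) + q (j + 2)) * (2 * p (m + 1) + (m + 2) * p m)
        else q j * (2 * (p (m + 1) + 2 * p (m + 2) + p (m + 3)) +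
          (m + 2) * (p m + 2 * p (m + 1) + p (m + 2)))) ≤
      80 * (1 + τ₀) ^ 3 / τ ^ 2 * (window τ q j * windowXY τ p m) := by
  have hτ0 : 0 < τ₀ := hτ.trans_le hτ₀
  have nA := window_nonneg hτ hq j
  have nB := windowXY_nonneg hτ hp m
  have nAB := mul_nonneg nA nB
  have wj := expWeight_nonneg hτ j
  have wm := expWeight_nonneg hτ m
  have hq0 := hq j
  have hq1 := hq (j + 1)
  have hq2 := hq (j + 2)
  have hp0 := hp m
  have hp1 := hp (m + 1)
  have hp2 := hp (m + 2)
  have hp3 := hp (m + 3)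
  rw [mfac_mul_choose, div_mul_eq_mul_div, le_div_iff₀ (by positivity)]
  change ((j : ℝ) + m + 1) ^ 4 * expWeight τ j * expWeight τ m * _ * _ ≤ _
  split_ifs with h
  · have hA := square_mul_weight_le hτ hτ₀ hq j
    have hB := vel_mul_weight_le hτ hτ₀ hp m
    have hAB := mul_le_mul hA hB (by positivity) (by positivity)
    have hpow := mul_le_mul_of_nonneg_right (add_add_one_pow_le h)
      (by positivity : 0 ≤ (τ ^ 2 * ((q j + 2 * q (j + 1) + q (j + 2)) * expWeight τ j)) *
        ((2 * p (m + 1) + (m + 2) * p m) * expWeight τ m))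
    calc _ = ((j : ℝ) + m + 1) ^ 4 *
          ((τ ^ 2 * ((q j + 2 * q (j + 1) + q (j + 2)) * expWeight τ j)) *
            ((2 * p (m + 1) + (m + 2) * p m) * expWeight τ m)) := by ring
      _ ≤ 16 * (2 * (1 + τ₀) ^ 2 * window τ q j * ((2 + τ₀) * windowXY τ p m)) := by
        linarith
      _ = 32 * (1 + τ₀) ^ 2 * (2 + τ₀) * (window τ q j * windowXY τ p m) := by ring
      _ ≤ _ := mul_le_mul_of_nonneg_right (by nlinarith [sq_nonneg (1 + τ₀)]) nAB
  · have hA := wX_pow_mul_le_window hτ hq j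
    have hB := vel_square_mul_weight_le hτ hτ₀ hp m
    have hAB := mul_le_mul hA hB (by positivity) (by positivity)
    have h' := add_add_one_pow_le (not_le.1 h).le
    have hpow := mul_le_mul_of_nonneg_right h'
      (by positivity : 0 ≤ (q j * expWeight τ j) *
        (τ ^ 2 * ((2 * (p (m + 1) + 2 * p (m + 2) + p (m + 3)) +
          (m + 2) * (p m + 2 * p (m + 1) + p (m + 2))) * expWeight τ m)))
    calc _ = ((m : ℝ) + j + 1) ^ 4 * ((q j * expWeight τ j) *
        (τ ^ 2 * ((2 * (p (m + 1) + 2 * p (m + 2) + p (m + 3)) +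
          (m + 2) * (p m + 2 * p (m + 1) + p (m + 2))) * expWeight τ m))) := by ring
      _ ≤ 16 * (window τ q j * (5 * (1 + τ₀) ^ 3 * windowXY τ p m)) := by linarith
      _ = _ := by ring

end terms

lemma sum_shift_le_tsum {u : ℕ → ℝ} (hu : ∀ n, 0 ≤ u n) (hs : Summable u) (k N : ℕ) :
    ∑ n ∈ Finset.range N, u (n + k) ≤ ∑' n, u n := by
  calc _ ≤ ∑' n, u (n + k) := ((summable_nat_add_iff k).2 hs).sum_le_tsum _ fun _ _ => hu _
    _ ≤ _ := by
      rw [← hs.sum_add_tsum_nat_add k]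
      exact le_add_of_nonneg_left (Finset.sum_nonneg fun _ _ => hu _)

lemma sum_window_le {τ : ℝ} {q : ℕ → ℝ} (hτ : 0 < τ) (hq : ∀ n, 0 ≤ q n)
    (hs : Summable (wX τ q)) (N : ℕ) :
    ∑ j ∈ Finset.range N, window τ q j ≤ 3 * ∑' n, wX τ q n := by
  have n := wX_nonneg hτ hq
  have h0 := sum_shift_le_tsum n hs 0 N
  have h1 := sum_shift_le_tsum n hs 1 N
  have h2 := sum_shift_le_tsum n hs 2 N
  simp only [window, Finset.sum_add_distrib]
  simp only [add_zero] at h0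
  linarith

lemma sum_windowXY_le {τ : ℝ} {p : ℕ → ℝ} (hτ : 0 < τ) (hp : ∀ n, 0 ≤ p n)
    (hX : Summable (wX τ p)) (hY : Summable (wY τ p)) (N : ℕ) :
    ∑ m ∈ Finset.range N, windowXY τ p m ≤ 4 * (∑' n, wX τ p n + ∑' n, wY τ p n) := by
  have nX := wX_nonneg hτ hp
  have nY := wY_nonneg hτ hp
  have h := sum_shift_le_tsum nX hX 0 N
  have h0 := sum_shift_le_tsum nY hY 0 N
  have h1 := sum_shift_le_tsum nY hY 1 N
  have h2 := sum_shift_le_tsum nY hY 2 N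
  have h3 := sum_shift_le_tsum nY hY 3 N
  have h4 : 0 ≤ ∑' n, wX τ p n := tsum_nonneg nX
  simp only [windowXY, Finset.sum_add_distrib]
  simp only [add_zero] at h h0
  linarith

lemma sum_levelSum_mul_le {u v : ℕ → ℝ} (hu : ∀ n, 0 ≤ u n) (hv : ∀ n, 0 ≤ v n) (N : ℕ) :
    ∑ n ∈ Finset.range N, levelSum (fun j m => u j * v m) n ≤
      (∑ j ∈ Finset.range N, u j) * ∑ m ∈ Finset.range N, v m := by
  simp only [levelSum_eq]
  rw [Finset.sum_mul_sum, ← Finset.sum_product', Finset.sum_sigma']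
  refine (Finset.sum_nbij (s := (Finset.range N).sigma fun n =>
      Finset.HasAntidiagonal.antidiagonal n)
    (t := ((Finset.range N ×ˢ Finset.range N).filter fun x => x.1 + x.2 < N))
    (g := fun x : ℕ × ℕ => u x.1 * v x.2) (fun x => x.2) ?_ ?_ ?_ fun _ _ => rfl).trans_le
    (Finset.sum_le_sum_of_subset_of_nonneg (Finset.filter_subset _ _)
      fun _ _ _ => mul_nonneg (hu _) (hv _))
  · rintro ⟨n, a, b⟩ h
    simp only [Finset.mem_sigma, Finset.mem_range, Finset.HasAntidiagonal.mem_antidiagonal,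
      Finset.mem_filter, Finset.mem_product] at h ⊢
    omega
  · rintro ⟨n, a, b⟩ h ⟨n', a', b'⟩ h' e
    simp only [Finset.coe_sigma, Set.mem_sigma_iff, Finset.mem_coe, Finset.mem_range,
      Finset.HasAntidiagonal.mem_antidiagonal, Prod.mk.injEq] at h h' e
    obtain ⟨rfl, rfl⟩ := e
    obtain ⟨_, rfl⟩ := h
    obtain ⟨_, rfl⟩ := h'
    rfl
  · rintro ⟨a, b⟩ h
    simp only [Finset.coe_filter, Set.mem_ofPred_eq] at h
    exact ⟨⟨a + b, a, b⟩, by simp [h.2], rfl⟩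

section assembly

variable {t τ τ₀ σ : ℝ} {g : ℝ → ℝ → ℝ → ℝ}

lemma levelSum_coeffK_le (hσ : 0 < σ) (j m : ℕ) :
    levelSum (fun i i' => levelSum (fun k k' => coeffK t σ g i i' k k') m) j ≤
      if j ≤ m then
        (levelSum (shearSum t σ g) j + 2 * levelSum (shearSum t σ g) (j + 1) +
          levelSum (shearSum t σ g) (j + 2)) *
          (2 * levelSum (nrmA t g) (m + 1) + (m + 2) * levelSum (nrmA t g) m)
      else levelSum (shearSum t σ g) j *
        (2 * (levelSum (nrmA t g) (m + 1) + 2 * levelSum (nrmA t g) (m + 2) +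
            levelSum (nrmA t g) (m + 3)) +
          (m + 2) * (levelSum (nrmA t g) m + 2 * levelSum (nrmA t g) (m + 1) +
            levelSum (nrmA t g) (m + 2))) := by
  have hn : ∀ a b, 0 ≤ nrmA t g a b := nrmA_nonneg
  have hs : ∀ a b, 0 ≤ shearSum t σ g a b := shearSum_nonneg hσ
  have ln := levelSum_nonneg hn
  have ls := levelSum_nonneg hs
  rw [levelSum_coeffK]
  split_ifs with h
  · refine mul_le_mul (levelSum_squareSum_le hs j) (levelSum_velSum_le hn m)
      (levelSum_nonneg (velSum_nonneg hn) m) ?_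
    linarith [ls j, ls (j + 1), ls (j + 2)]
  · refine mul_le_mul_of_nonneg_left ?_ (ls j)
    refine (levelSum_velSum_le (squareSum_nonneg hn) m).trans ?_
    have h1 := levelSum_squareSum_le hn (m + 1)
    have h2 := levelSum_squareSum_le hn m
    have h3 := mul_le_mul_of_nonneg_left h2 (by positivity : (0 : ℝ) ≤ m + 2)
    linarith

lemma qterm_I7_le (hg : Smooth3 g) (hσ : 0 < σ) (hw : angT t = σ ^ 4) (hc : L2cond t g)
    (hz : L2condZ t g) (hτ : 0 < τ) (hτ₀ : τ ≤ τ₀) (n : ℕ) :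
    Qterm t τ g (I7 t g) n ≤ 19200 * (80 * (1 + τ₀) ^ 3 / τ ^ 2) *
      levelSum (fun j m => window τ (levelSum (shearSum t σ g)) j *
        windowXY τ (levelSum (nrmA t g)) m) n := by
  have hM := mfac_nonneg n
  have hK : ∀ i j k l, 0 ≤ coeffK t σ g i j k l := coeffK_nonneg hσ
  calc Qterm t τ g (I7 t g) n
      ≤ 19200 * (τ ^ n * Mfac n) * levelSum (fun a b => leib a b (coeffK t σ g)) n := by
        rw [levelSum, Finset.mul_sum, Qterm]
        refine Finset.sum_le_sum fun a ha => ?_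
        have hn : a + (n - a) = n := by have := Finset.mem_range.1 ha; omega
        have hL := leib_nonneg a (n - a) hK
        have h := abs_I7_le hg hσ hw hc hz a (n - a)
        rw [nrmA, hn] at h
        refine div_le_of_le_mul₀ (Real.sqrt_nonneg _) (by positivity) ?_
        calc _ = |I7 t g a (n - a)| * (τ ^ n * Mfac n) := by ring
          _ ≤ 19200 * leib a (n - a) (coeffK t σ g) * L2w t 1 n (pdh a (n - a) g) *
              (τ ^ n * Mfac n) := mul_le_mul_of_nonneg_right h (by positivity)
          _ = _ := by ring
    _ ≤ 19200 * (τ ^ n * Mfac n) * levelSum (fun j m => (n.choose j : ℝ) *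
          levelSum (fun i i' => levelSum (fun k k' => coeffK t σ g i i' k k') m) j) n :=
        mul_le_mul_of_nonneg_left (levelSum_leib_le hK n) (by positivity)
    _ ≤ _ := by
        rw [← levelSum_mul_left, ← levelSum_mul_left]
        refine levelSum_mono fun j m hjm => ?_
        subst hjm
        have h1 := mul_le_mul_of_nonneg_left (levelSum_coeffK_le (t := t) (g := g) hσ j m)
          (by positivity : 0 ≤ 19200 * (τ ^ (j + m) * Mfac (j + m) * ((j + m).choose j : ℝ)))
        have h2 := weighted_product_le hτ hτ₀ (levelSum_nonneg (nrmA_nonneg (t := t) (f := g)))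
          (levelSum_nonneg (shearSum_nonneg (t := t) (g := g) hσ)) j m
        calc _ = 19200 * (τ ^ (j + m) * Mfac (j + m) * ((j + m).choose j : ℝ)) *
              levelSum (fun i i' => levelSum (fun k k' => coeffK t σ g i i' k k') m) j := by ring
          _ ≤ _ := h1
          _ = 19200 * (τ ^ (j + m) * Mfac (j + m) * ((j + m).choose j : ℝ) * _) :=
            mul_assoc _ _ _
          _ ≤ _ := mul_le_mul_of_nonneg_left h2 (by norm_num)
          _ = _ := (mul_assoc _ _ _).symm

lemma levelSum_nrmA (f : ℝ → ℝ → ℝ → ℝ) (n : ℕ) :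
    levelSum (nrmA t f) n = ∑ a ∈ Finset.range (n + 1), L2w t 1 n (pdh a (n - a) f) :=
  Finset.sum_congr rfl fun a ha => by
    rw [nrmA, show a + (n - a) = n by have := Finset.mem_range.1 ha; omega]

lemma wX_levelSum_nrmA : wX τ (levelSum (nrmA t g)) = Xel t τ g := by
  funext n; rw [wX, levelSum_nrmA, Xel]

lemma wY_levelSum_nrmA : wY τ (levelSum (nrmA t g)) = Yel t τ g := by
  funext n; rw [wY, levelSum_nrmA, Yel]

lemma wX_levelSum_shearSum :
    wX τ (levelSum (shearSum t σ g)) = fun n => σ * Del t τ g n + σ⁻¹ * Xel t τ g n := by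
  funext n
  have h : levelSum (shearSum t σ g) n =
      σ * levelSum (nrmA t (pdz g)) n + σ⁻¹ * levelSum (nrmA t g) n := by
    rw [← levelSum_mul_left, ← levelSum_mul_left, ← levelSum_add]; rfl
  rw [wX, h, levelSum_nrmA, levelSum_nrmA, Del, Xel]
  ring

lemma sum_qterm_I7_le (hg : Smooth3 g) (hσ : 0 < σ) (hw : angT t = σ ^ 4) (hc : L2cond t g)
    (hz : L2condZ t g) (hτ : 0 < τ) (hτ₀ : τ ≤ τ₀) (hX : Summable (Xel t τ g))
    (hD : Summable (Del t τ g)) (hY : Summable (Yel t τ g)) (N : ℕ) :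
    ∑ n ∈ Finset.range N, Qterm t τ g (I7 t g) n ≤
      18432000 * (1 + τ₀) ^ 3 / τ ^ 2 * (σ⁻¹ * Xnrm t τ g + σ * Dnrm t τ g) *
        (Xnrm t τ g + Ynrm t τ g) := by
  have hτ0 : 0 < τ₀ := hτ.trans_le hτ₀
  have hp := levelSum_nonneg (nrmA_nonneg (t := t) (f := g))
  have hq := levelSum_nonneg (shearSum_nonneg (t := t) (g := g) hσ)
  have nA := window_nonneg hτ hq
  have nB := windowXY_nonneg hτ hp
  have hsQ : Summable (wX τ (levelSum (shearSum t σ g))) := by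
    rw [wX_levelSum_shearSum]
    exact (hD.mul_left σ).add (hX.mul_left σ⁻¹)
  have hA := sum_window_le hτ hq hsQ N
  have hB := sum_windowXY_le hτ hp (wX_levelSum_nrmA (t := t) (g := g) ▸ hX)
    (wY_levelSum_nrmA (t := t) (g := g) ▸ hY) N
  rw [wX_levelSum_nrmA, wY_levelSum_nrmA] at hB
  have hAB := mul_le_mul hA hB (Finset.sum_nonneg fun _ _ => nB _)
    (mul_nonneg (by norm_num) (tsum_nonneg (wX_nonneg hτ hq)))
  rw [wX_levelSum_shearSum, (hD.mul_left σ).tsum_add (hX.mul_left σ⁻¹), tsum_mul_left,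
    tsum_mul_left] at hAB
  calc _ ≤ ∑ n ∈ Finset.range N, 19200 * (80 * (1 + τ₀) ^ 3 / τ ^ 2) *
        levelSum (fun j m => window τ (levelSum (shearSum t σ g)) j *
          windowXY τ (levelSum (nrmA t g)) m) n :=
        Finset.sum_le_sum fun n _ => qterm_I7_le hg hσ hw hc hz hτ hτ₀ n
    _ = 19200 * (80 * (1 + τ₀) ^ 3 / τ ^ 2) * ∑ n ∈ Finset.range N,
        levelSum (fun j m => window τ (levelSum (shearSum t σ g)) j *
          windowXY τ (levelSum (nrmA t g)) m) n := (Finset.mul_sum _ _ _).symm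
    _ ≤ 19200 * (80 * (1 + τ₀) ^ 3 / τ ^ 2) *
        (3 * (σ * Dnrm t τ g + σ⁻¹ * Xnrm t τ g) * (4 * (Xnrm t τ g + Ynrm t τ g))) :=
        mul_le_mul_of_nonneg_left ((sum_levelSum_mul_le nA nB N).trans hAB) (by positivity)
    _ = _ := by ring

end assembly

/-- estimate of the term `I₇`. -/
theorem estimate_I7 (τ₀ : ℝ) (hτ₀ : 0 < τ₀) :
    ∃ C : ℝ, 0 < C ∧
      ∀ t : ℝ, 0 ≤ t → ∀ g : ℝ → ℝ → ℝ → ℝ, DecaySmooth g → L2cond t g → L2condZ t g →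
        ∀ τ : ℝ, 0 < τ → τ ≤ τ₀ →
          Summable (Xel t τ g) → Summable (Del t τ g) → Summable (Yel t τ g) →
          ∀ N : ℕ,
            (∑ n ∈ Finset.range N, Qterm t τ g (I7 t g) n) ≤
              C / τ ^ 2 *
                (angT t ^ (-(1 : ℝ) / 4) * Xnrm t τ g + angT t ^ ((1 : ℝ) / 4) * Dnrm t τ g) *
                (Xnrm t τ g + Ynrm t τ g) := by
  refine ⟨18432000 * (1 + τ₀) ^ 3, by positivity, ?_⟩
  intro t ht g hg hc hz τ hτ hle hX hD hY N
  have hT : 0 < angT t := by unfold angT; linarith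
  have hw : angT t = (angT t ^ ((1 : ℝ) / 4)) ^ 4 := by
    rw [← Real.rpow_natCast, ← Real.rpow_mul hT.le]
    norm_num
  rw [neg_div, Real.rpow_neg hT.le]
  exact sum_qterm_I7_le hg.1 (Real.rpow_pos_of_pos hT _) hw hc hz hτ hle hX hD hY N
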